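/- Let α be a rational number with α > e + 2(a₀+a₁+a₂)/3, let H be a height associated to −K_X + αF, and let U be a nonempty Zariski-open subset of X with U(k) ≠ ∅ such that Δ(y) ≠ 0 and x₂ ≠ 0 at every point of U. For y ∈ ℙⁿ(k) with Δ(y) ≠ 0, let c_y := lim_{B→∞} N(X_y ∩ U, H, B)/B (this limit exists), where X_y = π^{−1}(y). Then the series c_{U,H} := Σ_{y ∈ ℙⁿ(k), Δ(y)≠0} c_y converges, and N(U,H,B) = c_{U,H}·B·(1+o(1)) as B → ∞. -/

import Mathlib

/-!
Setup (Frei–Loughran, "Rational points and non-anticanonical height functions",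
§2–§3): `k` a number field, `X ⊂ F_n(a₀,a₁,a₂)` a smooth hypersurface of
bidegree `(e,2)` cut out by `Q(y,x) = ∑ f_{i,j}(y) xᵢ xⱼ`, with projection
`π : X → ℙⁿ`, discriminant `Δ(y) = det (f_{i,j}(y))`, and standard height `H*`
associated to the `ℚ`-divisor `-K_X + αF`.
-/

noncomputable section

open MvPolynomial NumberField Filter Topology IsDedekindDomain

namespace Stmt

variable (k : Type) [Field k] [NumberField k] (n : ℕ)

/-- A representative `(y, x)` of a `k`-rational point of the hypersurface
`X : ∑_{i,j} f_{i,j}(y) xᵢxⱼ = 0` inside the bundle `F_n(a₀,a₁,a₂)`. -/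
structure PtRep (f : Fin 3 → Fin 3 → MvPolynomial (Fin (n + 1)) (𝓞 k)) : Type where
  y : Fin (n + 1) → k
  x : Fin 3 → k
  hy : y ≠ 0
  hx : x ≠ 0
  hQ : ∑ i : Fin 3, ∑ j : Fin 3, (aeval y (f i j)) * x i * x j = 0

variable {k n}

/-- Two representatives give the same point of `F_n(a₀,a₁,a₂)(k)` iff they differ
by the action of `𝔾ₘ²`: `(λ,μ)·(y;x) = (λy; λ^{-a₀}μx₀, λ^{-a₁}μx₁, λ^{-a₂}μx₂)`. -/
def ptRel (a : Fin 3 → ℤ) (f : Fin 3 → Fin 3 → MvPolynomial (Fin (n + 1)) (𝓞 k))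
    (P P' : PtRep k n f) : Prop :=
  ∃ l m : kˣ, (∀ i, P'.y i = (l : k) * P.y i) ∧
    ∀ j, P'.x j = ((l ^ (-(a j)) * m : kˣ) : k) * P.x j

/-- The counting function `N(U, H, B)`: the number of points of `X(k)` lying in `U`
and of height at most `B`.  (Points of `X(k)` are classes of representatives.) -/
def Ncount (a : Fin 3 → ℤ) (f : Fin 3 → Fin 3 → MvPolynomial (Fin (n + 1)) (𝓞 k))
    (U : Set (PtRep k n f)) (H : PtRep k n f → ℝ) (B : ℝ) : ℕ :=
  Nat.card {q : Quot (ptRel a f) // ∃ P, P ∈ U ∧ H P ≤ B ∧ Quot.mk (ptRel a f) P = q}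

/-- `max_i |z i|_w` at an infinite place `w`. -/
def maxAt {ι : Type} [Fintype ι] [Nonempty ι] (w : InfinitePlace k) (z : ι → k) : ℝ :=
  Finset.univ.sup' Finset.univ_nonempty fun i => w (z i)

/-- The normalized absolute value `|z|_v^{m_v} = 𝔑(𝔭_v)^{-ord_v(z)}` attached to a
finite place (height-one prime) `v` of `k`. -/
def fnorm (v : HeightOneSpectrum (𝓞 k)) (z : k) : ℝ :=
  if h : v.valuation k z = 0 then 0
  else (Ideal.absNorm v.asIdeal : ℝ) ^ (Multiplicative.toAdd (WithZero.unzero h))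

/-- `max_i |z i|_v^{m_v}` at a finite place `v`. -/
def maxAtFin {ι : Type} [Fintype ι] [Nonempty ι] (v : HeightOneSpectrum (𝓞 k)) (z : ι → k) : ℝ :=
  Finset.univ.sup' Finset.univ_nonempty fun i => fnorm v (z i)

/-- The exponent `A = n + 1 + α - (a₀ + a₁ + a₂ + e)`. -/
def Aexp (n : ℕ) (a : Fin 3 → ℤ) (e : ℤ) (α : ℚ) : ℝ :=
  (n : ℝ) + 1 + (α : ℝ) - (((a 0 : ℤ) : ℝ) + ((a 1 : ℤ) : ℝ) + ((a 2 : ℤ) : ℝ) + (e : ℝ))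

/-- The standard height `H*(y;x) = ∏_v (max_i |y_i|_v^A · max_j (max_i |y_i|_v^{a_j} |x_j|_v))^{m_v}`
associated to the `ℚ`-divisor `-K_X + αF = M + AF`. -/
def Hstd (a : Fin 3 → ℤ) (e : ℤ) (α : ℚ)
    (f : Fin 3 → Fin 3 → MvPolynomial (Fin (n + 1)) (𝓞 k)) (P : PtRep k n f) : ℝ :=
  (∏ w : InfinitePlace k,
      (maxAt w P.y ^ Aexp n a e α *
        Finset.univ.sup' Finset.univ_nonempty
          (fun j => maxAt w P.y ^ ((a j : ℤ) : ℝ) * w (P.x j))) ^ w.mult) *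
  ∏ᶠ v : HeightOneSpectrum (𝓞 k),
      (maxAtFin v P.y ^ Aexp n a e α *
        Finset.univ.sup' Finset.univ_nonempty
          (fun j => maxAtFin v P.y ^ ((a j : ℤ) : ℝ) * fnorm v (P.x j)))

/-- The defining polynomial `Q = ∑_{i,j} f_{i,j}(y) xᵢxⱼ`, as a polynomial over `k`
  in the variables `y₀, …, y_n, x₀, x₁, x₂`. -/
def Qk (f : Fin 3 → Fin 3 → MvPolynomial (Fin (n + 1)) (𝓞 k)) :
    MvPolynomial (Fin (n + 1) ⊕ Fin 3) k :=
  ∑ i : Fin 3, ∑ j : Fin 3,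
    rename Sum.inl (map (algebraMap (𝓞 k) k) (f i j)) * X (Sum.inr i) * X (Sum.inr j)

/-- Smoothness of the hypersurface `X : Q = 0`: at every point over an algebraic
closure of `k` (with `y ≠ 0`, `x ≠ 0`) where `Q` vanishes, some partial derivative
of `Q` is nonzero. -/
def IsSmoothX (f : Fin 3 → Fin 3 → MvPolynomial (Fin (n + 1)) (𝓞 k)) : Prop :=
  ∀ y : Fin (n + 1) → AlgebraicClosure k, ∀ x : Fin 3 → AlgebraicClosure k,
    y ≠ 0 → x ≠ 0 → aeval (Sum.elim y x) (Qk f) = 0 →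
      ∃ s, aeval (Sum.elim y x) (pderiv s (Qk f)) ≠ 0

/-- The coefficients `f_{i,j}` are symmetric and homogeneous of degree `aᵢ + aⱼ + e`,
so that `Q` is bihomogeneous of bidegree `(e,2)` on `F_n(a₀,a₁,a₂)`. -/
def DegOK (a : Fin 3 → ℤ) (e : ℤ) (f : Fin 3 → Fin 3 → MvPolynomial (Fin (n + 1)) (𝓞 k)) : Prop :=
  ∀ i j, f i j = f j i ∧ (f i j).IsHomogeneous (a i + a j + e).toNat ∧
    (a i + a j + e < 0 → f i j = 0)

/-- The discriminant `Δ(y) = det (f_{i,j}(y))`, evaluated at `y ∈ kⁿ⁺¹`. -/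
def Deltak (f : Fin 3 → Fin 3 → MvPolynomial (Fin (n + 1)) (𝓞 k))
    (y : Fin (n + 1) → k) : k :=
  Matrix.det (Matrix.of fun i j => aeval y (f i j))

/-- A polynomial in the Cox ring of `F_n(a₀,a₁,a₂)` is bihomogeneous (of some bidegree
`(d₁,d₂)`) with respect to the `𝔾ₘ²`-action; the nonvanishing loci of such polynomials
define the open subsets of `F_n(a₀,a₁,a₂)`. -/
def IsBihom (a : Fin 3 → ℤ) (g : MvPolynomial (Fin (n + 1) ⊕ Fin 3) k) : Prop :=
  ∃ (d₁ : ℤ) (d₂ : ℕ), ∀ (l m : kˣ) (y : Fin (n + 1) → k) (x : Fin 3 → k),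
    eval (Sum.elim (fun i => (l : k) * y i) fun j => ((l ^ (-(a j)) * m : kˣ) : k) * x j) g =
      (l : k) ^ d₁ * (m : k) ^ d₂ * eval (Sum.elim y x) g

/-- The set of representatives of points of `X(k)` lying in the fibre `X_y = π⁻¹(y)`
above the point `y = (y₀ : ⋯ : y_n) ∈ ℙⁿ(k)`. -/
def fiberSet (f : Fin 3 → Fin 3 → MvPolynomial (Fin (n + 1)) (𝓞 k))
    (y : Fin (n + 1) → k) : Set (PtRep k n f) :=
  {P | ∃ l : kˣ, ∀ i, P.y i = (l : k) * y i}

/-- Two nonzero vectors in `kⁿ⁺¹` represent the same point of `ℙⁿ(k)`. -/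
def projRel (y y' : {z : Fin (n + 1) → k // z ≠ 0}) : Prop :=
  ∃ l : kˣ, ∀ i, y'.1 i = (l : k) * y.1 i

/-- The set of points of `ℙⁿ(k)` at which the discriminant `Δ` does not vanish. -/
def deltaNonzeroClasses (f : Fin 3 → Fin 3 → MvPolynomial (Fin (n + 1)) (𝓞 k)) :
    Set (Quot (projRel (k := k) (n := n))) :=
  {q | ∃ yr : {z : Fin (n + 1) → k // z ≠ 0}, Quot.mk projRel yr = q ∧ Deltak f yr.1 ≠ 0}

set_option linter.unusedSectionVars false

section FiniteProducts

/-- Finite products of real powers of almost-everywhere trivial families. -/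
theorem finprod_rpow {V : Type*} {φ : V → ℝ} (hφ : ∀ᶠ v in cofinite, φ v = 1)
    (h0 : ∀ v, 0 ≤ φ v) (r : ℝ) : ∏ᶠ v, φ v ^ r = (∏ᶠ v, φ v) ^ r := by
  have hfin : {v | ¬ φ v = 1}.Finite := hφ
  rw [finprod_eq_prod_of_mulSupport_subset (s := hfin.toFinset) φ (by intro v hv; simpa using hv),
    finprod_eq_prod_of_mulSupport_subset (s := hfin.toFinset) _ ?_,
    Real.finsetProd_rpow _ _ fun v _ => h0 v]
  intro v hv
  simp only [Set.Finite.coe_toFinset, Set.mem_ofPred_eq]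
  intro h
  simp [h] at hv

theorem finprod_le_finprod_of_eventually {V : Type*} {φ ψ : V → ℝ}
    (hφ : ∀ᶠ v in cofinite, φ v = 1) (hψ : ∀ᶠ v in cofinite, ψ v = 1)
    (h0 : ∀ v, 0 ≤ φ v) (h : ∀ v, φ v ≤ ψ v) : ∏ᶠ v, φ v ≤ ∏ᶠ v, ψ v := by
  have hfin : {v | ¬ (φ v = 1 ∧ ψ v = 1)}.Finite := hφ.and hψ
  rw [finprod_eq_prod_of_mulSupport_subset (s := hfin.toFinset) φ ?_,
    finprod_eq_prod_of_mulSupport_subset (s := hfin.toFinset) ψ ?_]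
  · exact Finset.prod_le_prod (fun v _ => h0 v) fun v _ => h v
  · intro v hv
    simp only [Set.Finite.coe_toFinset, Set.mem_ofPred_eq]
    exact fun h => hv h.2
  · intro v hv
    simp only [Set.Finite.coe_toFinset, Set.mem_ofPred_eq]
    exact fun h => hv h.1

theorem finprod_mul_of_eventually {V : Type*} {φ ψ : V → ℝ}
    (hφ : ∀ᶠ v in cofinite, φ v = 1) (hψ : ∀ᶠ v in cofinite, ψ v = 1) :
    ∏ᶠ v, φ v * ψ v = (∏ᶠ v, φ v) * ∏ᶠ v, ψ v :=
  finprod_mul_distrib hφ hψ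

theorem finprod_sumType {V W : Type*} [Fintype V] {φ : V ⊕ W → ℝ}
    (hφ : ∀ᶠ v in cofinite, φ v = 1) :
    ∏ᶠ v, φ v = (∏ v, φ (.inl v)) * ∏ᶠ w, φ (.inr w) := by
  have hfin : {v | ¬ φ v = 1}.Finite := hφ
  have hr : {w | ¬ φ (.inr w) = 1}.Finite := hfin.preimage Sum.inr_injective.injOn
  rw [finprod_eq_prod_of_mulSupport_subset (s := Finset.univ.disjSum hr.toFinset) φ ?_,
    finprod_eq_prod_of_mulSupport_subset (s := hr.toFinset) (fun w => φ (.inr w)) ?_,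
    Finset.prod_disjSum]
  · intro w hw
    simpa using hw
  · rintro (v | w) hv
    · simp
    · simpa using hv

theorem sup'_pow {ι : Type*} {s : Finset ι} (hs : s.Nonempty) {φ : ι → ℝ} (h0 : ∀ i, 0 ≤ φ i)
    (m : ℕ) : (s.sup' hs φ) ^ m = s.sup' hs fun i => φ i ^ m := by
  apply le_antisymm
  · obtain ⟨i, hi, h⟩ := s.exists_mem_eq_sup' hs φ
    rw [h]
    exact Finset.le_sup' (fun i => φ i ^ m) hi
  · refine Finset.sup'_le _ _ fun i hi => ?_
    exact pow_le_pow_left₀ (h0 i) (Finset.le_sup' φ hi) m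

end FiniteProducts

section Places

variable (k) in
/-- The places of `k`. -/
abbrev Place : Type := InfinitePlace k ⊕ HeightOneSpectrum (𝓞 k)

theorem fnorm_eq (v : HeightOneSpectrum (𝓞 k)) (z : k) : fnorm v z = FinitePlace.mk v z := by
  rw [FinitePlace.mk_apply, FinitePlace.norm_embedding']
  unfold fnorm
  split_ifs with h
  · simp [h]
  · rw [WithZeroMulInt.toNNReal_neg_apply _ h]
    simp

/-- The normalized absolute value `|z|_v ^ m_v` at a place `v`. -/
def nrm : Place k → k →*₀ ℝ
  | .inl w => (powMonoidWithZeroHom w.mult_ne_zero).comp (MonoidWithZeroHom.ofClass w)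
  | .inr v => MonoidWithZeroHom.ofClass (FinitePlace.mk v)

theorem nrm_inl (w : InfinitePlace k) (z : k) : nrm (.inl w) z = w z ^ w.mult := rfl

theorem nrm_inr (v : HeightOneSpectrum (𝓞 k)) (z : k) : nrm (.inr v) z = FinitePlace.mk v z := rfl

theorem nrm_inr_eq_fnorm (v : HeightOneSpectrum (𝓞 k)) (z : k) : nrm (.inr v) z = fnorm v z :=
  (fnorm_eq v z).symm

theorem nrm_nonneg (v : Place k) (z : k) : 0 ≤ nrm v z := by
  rcases v with w | v
  · rw [nrm_inl]; positivity
  · rw [nrm_inr]; exact apply_nonneg _ _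

theorem nrm_pos (v : Place k) {z : k} (hz : z ≠ 0) : 0 < nrm v z :=
  (nrm_nonneg v z).lt_of_ne' ((map_ne_zero _).2 hz)

theorem eventually_nrm_eq_one {z : k} (hz : z ≠ 0) : ∀ᶠ v : Place k in cofinite, nrm v z = 1 := by
  have h : {w : FinitePlace k | ¬ w z = 1}.Finite := FinitePlace.hasFiniteMulSupport hz
  have h1 : (Set.range (Sum.inl : InfinitePlace k → Place k) ∪
    (fun w : FinitePlace k => (Sum.inr w.maximalIdeal : Place k)) '' {w | ¬ w z = 1}).Finite :=
    (Set.finite_range _).union (h.image _)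
  refine h1.subset ?_
  rintro (w | v) hv
  · exact .inl ⟨w, rfl⟩
  · exact .inr ⟨FinitePlace.mk v, hv, congrArg Sum.inr (FinitePlace.maximalIdeal_mk v)⟩

theorem finprod_mk_eq (φ : FinitePlace k → ℝ) :
    ∏ᶠ v : HeightOneSpectrum (𝓞 k), φ (FinitePlace.mk v) = ∏ᶠ v : FinitePlace k, φ v :=
  finprod_comp_equiv (FinitePlace.equivHeightOneSpectrum (K := k)).symm

theorem finprod_nrm {z : k} (hz : z ≠ 0) : ∏ᶠ v : Place k, nrm v z = 1 := by
  rw [finprod_sumType (eventually_nrm_eq_one hz), ← prod_abs_eq_one hz]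
  simp only [nrm_inl, nrm_inr]
  rw [finprod_mk_eq fun v => v z]

theorem nrm_add_le (v : HeightOneSpectrum (𝓞 k)) (x y : k) :
    nrm (.inr v) (x + y) ≤ max (nrm (.inr v) x) (nrm (.inr v) y) :=
  FinitePlace.add_le (FinitePlace.mk v) x y

theorem nrm_neg (v : HeightOneSpectrum (𝓞 k)) (x : k) : nrm (.inr v) (-x) = nrm (.inr v) x :=
  map_neg_eq_map (FinitePlace.mk v) x

theorem nrm_integer_le_one (v : HeightOneSpectrum (𝓞 k)) (x : 𝓞 k) :
    nrm (.inr v) (x : k) ≤ 1 := FinitePlace.norm_le_one k v x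

theorem nrm_integer_eq_one_iff (v : HeightOneSpectrum (𝓞 k)) (x : 𝓞 k) :
    nrm (.inr v) (x : k) = 1 ↔ x ∉ v.asIdeal := FinitePlace.norm_eq_one_iff_notMem k v x

end Places

section LocalHeights

variable {ι : Type} [Fintype ι] [Nonempty ι]

/-- The maximum `max_i |z_i|_v ^ m_v` at a place `v`. -/
def vmax (v : Place k) (z : ι → k) : ℝ :=
  Finset.univ.sup' Finset.univ_nonempty fun i => nrm v (z i)

theorem nrm_le_vmax (v : Place k) (z : ι → k) (i : ι) : nrm v (z i) ≤ vmax v z :=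
  Finset.le_sup' (fun i => nrm v (z i)) (Finset.mem_univ i)

theorem exists_vmax_eq (v : Place k) (z : ι → k) : ∃ i, vmax v z = nrm v (z i) := by
  obtain ⟨i, -, h⟩ := Finset.exists_mem_eq_sup' Finset.univ_nonempty fun i => nrm v (z i)
  exact ⟨i, h⟩

theorem vmax_le {v : Place k} {z : ι → k} {B : ℝ} (h : ∀ i, nrm v (z i) ≤ B) : vmax v z ≤ B :=
  Finset.sup'_le _ _ fun i _ => h i

theorem vmax_nonneg (v : Place k) (z : ι → k) : 0 ≤ vmax v z :=
  (nrm_nonneg v _).trans (nrm_le_vmax v z (Classical.arbitrary ι))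

theorem vmax_pos (v : Place k) {z : ι → k} (hz : z ≠ 0) : 0 < vmax v z := by
  obtain ⟨i, hi⟩ := Function.ne_iff.1 hz
  exact (nrm_pos v hi).trans_le (nrm_le_vmax v z i)

theorem eventually_vmax_eq_one {z : ι → k} (hz : z ≠ 0) :
    ∀ᶠ v : Place k in cofinite, vmax v z = 1 := by
  have h : ∀ᶠ v : Place k in cofinite, ∀ i, z i ≠ 0 → nrm v (z i) = 1 := by
    refine eventually_all.2 fun i => ?_
    by_cases hi : z i = 0
    · simp [hi]
    · exact (eventually_nrm_eq_one hi).mono fun v hv _ => hv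
  filter_upwards [h] with v hv
  obtain ⟨i, hi⟩ := Function.ne_iff.1 hz
  refine le_antisymm (vmax_le fun j => ?_) ((hv i hi).symm.le.trans (nrm_le_vmax v z i))
  by_cases hj : z j = 0
  · simp [hj]
  · exact (hv j hj).le

theorem vmax_smul (v : Place k) (c : k) (z : ι → k) :
    vmax v (fun i => c * z i) = nrm v c * vmax v z := by
  unfold vmax
  rw [Finset.mul₀_sup' (nrm_nonneg v c)]
  simp

theorem maxAt_pow (w : InfinitePlace k) (z : ι → k) : maxAt w z ^ w.mult = vmax (.inl w) z := by
  rw [maxAt, sup'_pow _ fun i => apply_nonneg w _]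
  rfl

theorem maxAt_nonneg (w : InfinitePlace k) (z : ι → k) : 0 ≤ maxAt w z :=
  (apply_nonneg w _).trans
    (Finset.le_sup' (fun i => w (z i)) (Finset.mem_univ (Classical.arbitrary ι)))

theorem le_maxAt (w : InfinitePlace k) (z : ι → k) (i : ι) : w (z i) ≤ maxAt w z :=
  Finset.le_sup' (fun i => w (z i)) (Finset.mem_univ i)

theorem maxAt_pos (w : InfinitePlace k) {z : ι → k} (hz : z ≠ 0) : 0 < maxAt w z := by
  obtain ⟨i, hi⟩ := Function.ne_iff.1 hz
  exact (w.pos_iff.2 hi).trans_le (le_maxAt w z i)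

theorem maxAtFin_eq (v : HeightOneSpectrum (𝓞 k)) (z : ι → k) :
    maxAtFin v z = vmax (.inr v) z := by
  simp only [maxAtFin, vmax, nrm_inr_eq_fnorm]

/-- The multiplicative height of a vector. -/
def ht (z : ι → k) : ℝ := ∏ᶠ v : Place k, vmax v z

theorem ht_smul {c : k} (hc : c ≠ 0) {z : ι → k} (hz : z ≠ 0) : ht (fun i => c * z i) = ht z := by
  simp only [ht, vmax_smul]
  rw [finprod_mul_of_eventually (eventually_nrm_eq_one hc) (eventually_vmax_eq_one hz),
    finprod_nrm hc, one_mul]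

theorem one_le_ht {z : ι → k} (hz : z ≠ 0) : 1 ≤ ht z := by
  obtain ⟨i, hi⟩ := Function.ne_iff.1 hz
  rw [← finprod_nrm hi]
  exact finprod_le_finprod_of_eventually (eventually_nrm_eq_one hi) (eventually_vmax_eq_one hz)
    (fun v => nrm_nonneg v _) fun v => nrm_le_vmax v z i

/-- The local factor `max_j (|y|_v ^ a_j |x_j|_v)` of the height. -/
def vmaxTw (a : Fin 3 → ℤ) (v : Place k) (y : ι → k) (x : Fin 3 → k) : ℝ :=
  Finset.univ.sup' Finset.univ_nonempty fun j => vmax v y ^ a j * nrm v (x j)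

theorem le_vmaxTw (a : Fin 3 → ℤ) (v : Place k) (y : ι → k) (x : Fin 3 → k) (j : Fin 3) :
    vmax v y ^ a j * nrm v (x j) ≤ vmaxTw a v y x :=
  Finset.le_sup' (fun j => vmax v y ^ a j * nrm v (x j)) (Finset.mem_univ j)

theorem vmaxTw_nonneg (a : Fin 3 → ℤ) (v : Place k) (y : ι → k) (x : Fin 3 → k) :
    0 ≤ vmaxTw a v y x :=
  (mul_nonneg (zpow_nonneg (vmax_nonneg v y) _) (nrm_nonneg v _)).trans (le_vmaxTw a v y x 0)

theorem vmaxTw_of_vmax_eq_one (a : Fin 3 → ℤ) {v : Place k} {y : ι → k} (hy : vmax v y = 1)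
    (x : Fin 3 → k) : vmaxTw a v y x = vmax v x := by
  simp only [vmaxTw, hy, one_zpow, one_mul]
  rfl

theorem eventually_vmaxTw_eq_one (a : Fin 3 → ℤ) {y : ι → k} {x : Fin 3 → k} (hy : y ≠ 0)
    (hx : x ≠ 0) : ∀ᶠ v : Place k in cofinite, vmaxTw a v y x = 1 := by
  filter_upwards [eventually_vmax_eq_one hy, eventually_vmax_eq_one hx] with v hv hv'
  rw [vmaxTw_of_vmax_eq_one a hv, hv']

/-- The twisted height of `x` with respect to `y`. -/
def htTw (a : Fin 3 → ℤ) (y : ι → k) (x : Fin 3 → k) : ℝ := ∏ᶠ v : Place k, vmaxTw a v y x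

theorem ht_zpow {y : ι → k} (hy : y ≠ 0) (m : ℤ) : ∏ᶠ v : Place k, vmax v y ^ m = ht y ^ m := by
  have := finprod_rpow (eventually_vmax_eq_one hy) (fun v => vmax_nonneg v y) (m : ℝ)
  simpa only [Real.rpow_intCast, ht] using this

theorem eventually_zpow_eq_one {y : ι → k} (hy : y ≠ 0) (m : ℤ) :
    ∀ᶠ v : Place k in cofinite, vmax v y ^ m = 1 := by
  filter_upwards [eventually_vmax_eq_one hy] with v hv
  rw [hv, one_zpow]

theorem ht_zpow_le_htTw (a : Fin 3 → ℤ) {y : ι → k} {x : Fin 3 → k} (hy : y ≠ 0) {j : Fin 3}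
    (hx : x j ≠ 0) : ht y ^ a j ≤ htTw a y x := by
  have hx0 : x ≠ 0 := fun h => hx (by simp [h])
  calc ht y ^ a j = ∏ᶠ v : Place k, vmax v y ^ a j * nrm v (x j) := by
        rw [finprod_mul_of_eventually (eventually_zpow_eq_one hy _) (eventually_nrm_eq_one hx),
          finprod_nrm hx, mul_one, ht_zpow hy]
    _ ≤ htTw a y x := by
        refine finprod_le_finprod_of_eventually ?_ (eventually_vmaxTw_eq_one a hy hx0)
          (fun v => mul_nonneg (zpow_nonneg (vmax_nonneg v y) _) (nrm_nonneg v _))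
          fun v => le_vmaxTw a v y x j
        filter_upwards [eventually_zpow_eq_one hy (a j), eventually_nrm_eq_one hx] with v h h'
        rw [h, h', mul_one]

end LocalHeights

theorem Hstd_eq (a : Fin 3 → ℤ) (e : ℤ) (α : ℚ)
    (f : Fin 3 → Fin 3 → MvPolynomial (Fin (n + 1)) (𝓞 k)) (P : PtRep k n f) :
    Hstd a e α f P = ht P.y ^ Aexp n a e α * htTw a P.y P.x := by
  have hy := eventually_vmax_eq_one P.hy
  have hA : ∀ᶠ v : Place k in cofinite, vmax v P.y ^ Aexp n a e α = 1 := by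
    filter_upwards [hy] with v hv
    rw [hv, Real.one_rpow]
  have hG := eventually_vmaxTw_eq_one a P.hy P.hx
  rw [ht, htTw, ← finprod_rpow hy fun v => vmax_nonneg v _, ← finprod_mul_of_eventually hA hG,
    finprod_sumType]
  · unfold Hstd
    congr 1
    · refine Finset.prod_congr rfl fun w _ => ?_
      have h0 := maxAt_nonneg w P.y
      rw [mul_pow, ← Real.rpow_mul_natCast h0, mul_comm (Aexp n a e α), Real.rpow_natCast_mul h0,
        maxAt_pow, sup'_pow _ fun j =>
          mul_nonneg (Real.rpow_nonneg h0 _) (apply_nonneg w _)]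
      congr 1
      unfold vmaxTw
      congr 1
      funext j
      rw [mul_pow, ← Real.rpow_mul_natCast h0, mul_comm ((a j : ℤ) : ℝ),
        Real.rpow_natCast_mul h0, maxAt_pow, Real.rpow_intCast, nrm_inl]
    · refine finprod_congr fun v => ?_
      simp only [maxAtFin_eq, vmaxTw, nrm_inr_eq_fnorm, Real.rpow_intCast]
  · filter_upwards [hA, hG] with v h h'
    rw [h, h', mul_one]

section ConicAlgebra

variable {K : Type*} [Field K]

/-- The matrix with rows `x`, `x'`, `x''` has this determinant. -/
def det3 (x x' x'' : Fin 3 → K) : K :=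
  x 0 * (x' 1 * x'' 2 - x' 2 * x'' 1) - x 1 * (x' 0 * x'' 2 - x' 2 * x'' 0) +
    x 2 * (x' 0 * x'' 1 - x' 1 * x'' 0)

/-- The bilinear form with Gram matrix `F`. -/
def bil (F : Matrix (Fin 3) (Fin 3) K) (x x' : Fin 3 → K) : K :=
  ∑ i, ∑ j, F i j * x i * x' j

theorem gram_identity {F : Matrix (Fin 3) (Fin 3) K} (hF : ∀ i j, F i j = F j i)
    (x x' x'' : Fin 3 → K) :
    det3 x x' x'' ^ 2 * F.det =
      bil F x x * (bil F x' x' * bil F x'' x'' - bil F x' x'' ^ 2) -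
      bil F x x' * (bil F x x' * bil F x'' x'' - bil F x' x'' * bil F x x'') +
      bil F x x'' * (bil F x x' * bil F x' x'' - bil F x' x' * bil F x x'') := by
  simp only [bil, det3, Matrix.det_fin_three, Fin.sum_univ_three, hF 1 0, hF 2 0, hF 2 1]
  ring

theorem det3_single (x x' : Fin 3 → K) :
    det3 x x' (Pi.single 0 1) = x 1 * x' 2 - x 2 * x' 1 ∧
    det3 x x' (Pi.single 1 1) = x 2 * x' 0 - x 0 * x' 2 ∧
    det3 x x' (Pi.single 2 1) = x 0 * x' 1 - x 1 * x' 0 := by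
  refine ⟨?_, ?_, ?_⟩ <;> simp [det3] <;> ring

theorem exists_smul_of_cross_eq {x x' : Fin 3 → K} (hx : x ≠ 0)
    (h : ∀ i j, x i * x' j = x j * x' i) : ∃ c, ∀ i, x' i = c * x i := by
  obtain ⟨j, hj⟩ := Function.ne_iff.1 hx
  refine ⟨x' j / x j, fun i => ?_⟩
  rw [div_mul_eq_mul_div, eq_div_iff hj, mul_comm, h j i, mul_comm]

/-- A nondegenerate conic contains no line. -/
theorem exists_smul_of_isotropic {F : Matrix (Fin 3) (Fin 3) K} (hF : ∀ i j, F i j = F j i)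
    (hdet : F.det ≠ 0) {x x' : Fin 3 → K} (hx : x ≠ 0) (h : bil F x x = 0) (h' : bil F x' x' = 0)
    (hb : bil F x x' = 0) : ∃ c, ∀ i, x' i = c * x i := by
  have key : ∀ z, det3 x x' z = 0 := fun z => by
    have := gram_identity hF x x' z
    rw [h, h', hb] at this
    have h0 : det3 x x' z ^ 2 * F.det = 0 := by rw [this]; ring
    exact pow_eq_zero_iff two_ne_zero |>.1 ((mul_eq_zero.1 h0).resolve_right hdet)
  obtain ⟨h0, h1, h2⟩ := det3_single x x'
  rw [key] at h0 h1 h2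
  refine exists_smul_of_cross_eq hx fun i j => ?_
  fin_cases i <;> fin_cases j <;> simp only [Fin.zero_eta, Fin.mk_one, Fin.reduceFinMk] <;> grind

/-- Three distinct points on a nondegenerate conic are not collinear. -/
theorem det3_ne_zero {F : Matrix (Fin 3) (Fin 3) K} (hF : ∀ i j, F i j = F j i)
    (hdet : F.det ≠ 0) (h2 : (2 : K) ≠ 0) {x x' x'' : Fin 3 → K} (hx : x ≠ 0) (hx' : x' ≠ 0)
    (h : bil F x x = 0) (h' : bil F x' x' = 0) (h'' : bil F x'' x'' = 0)
    (h01 : ¬ ∃ c, ∀ i, x' i = c * x i) (h02 : ¬ ∃ c, ∀ i, x'' i = c * x i)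
    (h12 : ¬ ∃ c, ∀ i, x'' i = c * x' i) : det3 x x' x'' ≠ 0 := by
  intro h0
  have := gram_identity hF x x' x''
  rw [h, h', h'', h0] at this
  have hz : 2 * (bil F x x' * bil F x x'' * bil F x' x'') = 0 := by linear_combination -this
  rcases mul_eq_zero.1 ((mul_eq_zero.1 hz).resolve_left h2) with hz | hz
  · rcases mul_eq_zero.1 hz with hz | hz
    · exact h01 (exists_smul_of_isotropic hF hdet hx h h' hz)
    · exact h02 (exists_smul_of_isotropic hF hdet hx h h'' hz)
  · exact h12 (exists_smul_of_isotropic hF hdet hx' h' h'' hz)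

end ConicAlgebra

section ConicLocal

variable (v : HeightOneSpectrum (𝓞 k))

theorem nrm_add_le_of_le {x y : k} {c : ℝ} (hx : nrm (.inr v) x ≤ c) (hy : nrm (.inr v) y ≤ c) :
    nrm (.inr v) (x + y) ≤ c := (nrm_add_le v x y).trans (max_le hx hy)

theorem nrm_sub_le_of_le {x y : k} {c : ℝ} (hx : nrm (.inr v) x ≤ c) (hy : nrm (.inr v) y ≤ c) :
    nrm (.inr v) (x - y) ≤ c := by
  rw [sub_eq_add_neg]
  exact nrm_add_le_of_le v hx (by rwa [nrm_neg])

theorem nrm_mul_le_of_le {x y : k} {b c : ℝ} (hx : nrm (.inr v) x ≤ b) (hy : nrm (.inr v) y ≤ c) :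
    nrm (.inr v) (x * y) ≤ b * c := by
  rw [map_mul]
  exact mul_le_mul hx hy (nrm_nonneg _ _) ((nrm_nonneg _ _).trans hx)

theorem nrm_sub_comm (x y : k) : nrm (.inr v) (x - y) = nrm (.inr v) (y - x) := by
  rw [← nrm_neg, neg_sub]

theorem nrm_add_eq_of_lt {x y : k} (h : nrm (.inr v) y < nrm (.inr v) x) :
    nrm (.inr v) (x + y) = nrm (.inr v) x := by
  refine le_antisymm (nrm_add_le_of_le v le_rfl h.le) (le_of_not_gt fun h' => ?_)
  have := (nrm_add_le v (x + y) (-y)).trans_lt (max_lt h' (by rwa [nrm_neg]))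
  simp at this

/-- Two points of a conic which are close in one coordinate are close in the other. -/
theorem nrm_chord {F : Matrix (Fin 3) (Fin 3) k} (hF : ∀ i j, F i j = F j i)
    (hint : ∀ i j, nrm (.inr v) (F i j) ≤ 1) (h2 : nrm (.inr v) 2 = 1) {u u' : Fin 3 → k}
    (hu : u 0 = 1) (hu' : u' 0 = 1) (hle : ∀ i, nrm (.inr v) (u i) ≤ 1)
    (hle' : ∀ i, nrm (.inr v) (u' i) ≤ 1)
    (hQ : bil F u u = 0) (hQ' : bil F u' u' = 0) (hd : nrm (.inr v) (F.mulVec u 2) = 1) {δ : ℝ}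
    (h1 : nrm (.inr v) (u' 1 - u 1) ≤ δ) (hδ : nrm (.inr v) (u' 1 - u 1) < 1)
    (ht : nrm (.inr v) (u' 2 - u 2) < 1) :
    nrm (.inr v) (F.mulVec (u + u') 2) = 1 ∧ nrm (.inr v) (F.mulVec (u + u') 1) ≤ 1 ∧
    F.mulVec (u + u') 1 * (u' 1 - u 1) + F.mulVec (u + u') 2 * (u' 2 - u 2) = 0 ∧
    nrm (.inr v) (u' 2 - u 2) ≤ δ := by
  have e2 : F.mulVec (u + u') 2 =
      2 * F.mulVec u 2 + (F 2 1 * (u' 1 - u 1) + F 2 2 * (u' 2 - u 2)) := by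
    simp only [Matrix.mulVec, dotProduct, Fin.sum_univ_three, Pi.add_apply, hu, hu']
    ring
  have hS : nrm (.inr v) (F.mulVec (u + u') 2) = 1 := by
    have hbig : nrm (.inr v) (2 * F.mulVec u 2) = 1 := by rw [map_mul, h2, hd, one_mul]
    rw [e2, nrm_add_eq_of_lt, hbig]
    rw [hbig]
    refine (nrm_add_le v _ _).trans_lt (max_lt ?_ ?_)
    · exact (nrm_mul_le_of_le v (hint 2 1) le_rfl).trans_lt (by rwa [one_mul])
    · exact (nrm_mul_le_of_le v (hint 2 2) le_rfl).trans_lt (by rwa [one_mul])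
  have hS1 : nrm (.inr v) (F.mulVec (u + u') 1) ≤ 1 := by
    have hs : ∀ i, nrm (.inr v) ((u + u') i) ≤ 1 := fun i => nrm_add_le_of_le v (hle i) (hle' i)
    simp only [Matrix.mulVec, dotProduct, Fin.sum_univ_three]
    have hm : ∀ i, nrm (.inr v) (F 1 i * (u + u') i) ≤ 1 := fun i => by
      simpa using nrm_mul_le_of_le v (hint 1 i) (hs i)
    exact nrm_add_le_of_le v (nrm_add_le_of_le v (hm 0) (hm 1)) (hm 2)
  have he : F.mulVec (u + u') 1 * (u' 1 - u 1) + F.mulVec (u + u') 2 * (u' 2 - u 2) = 0 := by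
    simp only [bil, Fin.sum_univ_three, hu, hu'] at hQ hQ'
    simp only [Matrix.mulVec, dotProduct, Fin.sum_univ_three, Pi.add_apply, hu, hu', hF 1 0,
      hF 2 0, hF 2 1] at hQ hQ' ⊢
    linear_combination hQ' - hQ
  refine ⟨hS, hS1, he, ?_⟩
  have : F.mulVec (u + u') 2 * (u' 2 - u 2) = -(F.mulVec (u + u') 1 * (u' 1 - u 1)) := by
    linear_combination he
  have := congrArg (nrm (.inr v)) this
  rw [map_mul, hS, one_mul, nrm_neg] at this
  rw [this]
  simpa using nrm_mul_le_of_le v hS1 h1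

theorem nrm_det3_normalized {F : Matrix (Fin 3) (Fin 3) k} (hF : ∀ i j, F i j = F j i)
    (hint : ∀ i j, nrm (.inr v) (F i j) ≤ 1) (h2 : nrm (.inr v) 2 = 1) (u : Fin 3 → Fin 3 → k)
    (hu : ∀ p, u p 0 = 1) (hle : ∀ p i, nrm (.inr v) (u p i) ≤ 1)
    (hQ : ∀ p, bil F (u p) (u p) = 0) (hd : ∀ p, nrm (.inr v) (F.mulVec (u p) 2) = 1)
    {δ : ℝ} (hδ : δ < 1) (h1 : ∀ p r, nrm (.inr v) (u p 1 - u r 1) ≤ δ)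
    (ht : ∀ p r, nrm (.inr v) (u p 2 - u r 2) < 1) :
    nrm (.inr v) (det3 (u 0) (u 1) (u 2)) ≤ δ ^ 3 := by
  obtain ⟨hS2, hS1, heS, -⟩ := nrm_chord v hF hint h2 (hu 0) (hu 1) (hle 0) (hle 1) (hQ 0) (hQ 1)
    (hd 0) (h1 1 0) ((h1 1 0).trans_lt hδ) (ht 1 0)
  obtain ⟨hT2, hT1, heT, -⟩ := nrm_chord v hF hint h2 (hu 0) (hu 2) (hle 0) (hle 2) (hQ 0) (hQ 2)
    (hd 0) (h1 2 0) ((h1 2 0).trans_lt hδ) (ht 2 0)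
  obtain ⟨-, -, -, h21⟩ := nrm_chord v hF hint h2 (hu 1) (hu 2) (hle 1) (hle 2) (hQ 1) (hQ 2)
    (hd 1) (h1 2 1) ((h1 2 1).trans_lt hδ) (ht 2 1)
  set S := F.mulVec (u 0 + u 1) with hSd
  set T := F.mulVec (u 0 + u 2) with hTd
  have hdiff : ∀ i, nrm (.inr v) (T i - S i) ≤ δ := fun i => by
    have : T i - S i = F i 1 * (u 2 1 - u 1 1) + F i 2 * (u 2 2 - u 1 2) := by
      simp only [hSd, hTd, Matrix.mulVec, dotProduct, Fin.sum_univ_three, Pi.add_apply, hu]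
      ring
    rw [this]
    refine nrm_add_le_of_le v ?_ ?_
    · simpa using nrm_mul_le_of_le v (hint i 1) (h1 2 1)
    · simpa using nrm_mul_le_of_le v (hint i 2) h21
  have hdet : S 2 * T 2 * det3 (u 0) (u 1) (u 2) =
      (u 1 1 - u 0 1) * (u 2 1 - u 0 1) * (S 2 * (S 1 - T 1) - S 1 * (S 2 - T 2)) := by
    simp only [det3, hu]
    linear_combination (u 1 1 - u 0 1) * S 2 * heT - (u 2 1 - u 0 1) * T 2 * heS
  have := congrArg (nrm (.inr v)) hdet
  rw [map_mul, map_mul, hS2, hT2, one_mul, one_mul] at this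
  rw [this]
  calc _ ≤ δ * δ * δ := ?_
    _ = δ ^ 3 := by ring
  refine nrm_mul_le_of_le v (nrm_mul_le_of_le v (h1 1 0) (h1 2 0)) (nrm_sub_le_of_le v ?_ ?_)
  · simpa using nrm_mul_le_of_le v hS2.le (by rw [nrm_sub_comm]; exact hdiff 1)
  · simpa using nrm_mul_le_of_le v hS1 (by rw [nrm_sub_comm]; exact hdiff 2)

end ConicLocal

section Residues

variable (v : HeightOneSpectrum (𝓞 k))

theorem one_lt_absNorm_real : (1 : ℝ) < Ideal.absNorm v.asIdeal :=
  mod_cast HeightOneSpectrum.one_lt_absNorm v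

theorem nrm_le_inv_pow_iff (x : k) (m : ℕ) :
    nrm (.inr v) x ≤ ((Ideal.absNorm v.asIdeal : ℝ) ^ m)⁻¹ ↔
      v.valuation k x ≤ WithZero.exp (-(m : ℤ)) := by
  have hmono := WithZeroMulInt.toNNReal_strictMono
    (HeightOneSpectrum.one_lt_absNorm_nnreal v)
  rw [← hmono.le_iff_le, nrm_inr, FinitePlace.mk_apply, FinitePlace.norm_embedding',
    ← NNReal.coe_le_coe]
  have : ((WithZeroMulInt.toNNReal (HeightOneSpectrum.absNorm_ne_zero v)
      (WithZero.exp (-(m : ℤ))) : NNReal) : ℝ) = ((Ideal.absNorm v.asIdeal : ℝ) ^ m)⁻¹ := by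
    rw [WithZeroMulInt.toNNReal_neg_apply _ WithZero.exp_ne_zero]
    have h : WithZero.unzero (WithZero.exp_ne_zero (a := -(m : ℤ))) =
      Multiplicative.ofAdd (-(m : ℤ)) := rfl
    rw [h]
    simp
  rw [this]

theorem nrm_integer_le_inv_pow_iff (x : 𝓞 k) (m : ℕ) :
    nrm (.inr v) (x : k) ≤ ((Ideal.absNorm v.asIdeal : ℝ) ^ m)⁻¹ ↔ x ∈ v.asIdeal ^ m := by
  rw [nrm_le_inv_pow_iff, ← HeightOneSpectrum.intValuation_le_pow_iff_mem,
    HeightOneSpectrum.valuation_of_algebraMap]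

/-- Residues modulo a prime power extend to the elements which are integral at the prime. -/
theorem exists_residue (m : ℕ) : ∃ ρ : k → 𝓞 k ⧸ v.asIdeal ^ m, ∀ s s' : k,
    nrm (.inr v) s ≤ 1 → nrm (.inr v) s' ≤ 1 → ρ s = ρ s' →
      nrm (.inr v) (s - s') ≤ ((Ideal.absNorm v.asIdeal : ℝ) ^ m)⁻¹ := by
  have key : ∀ s : k, ∃ r : 𝓞 k, nrm (.inr v) s ≤ 1 →
      nrm (.inr v) ((r : k) - s) ≤ ((Ideal.absNorm v.asIdeal : ℝ) ^ m)⁻¹ := by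
    intro s
    by_cases hs : nrm (.inr v) s ≤ 1
    · have hs' : v.valuation k s ≤ 1 := by
        have := (nrm_le_inv_pow_iff v s 0).1 (by simpa using hs)
        simpa using this
      obtain ⟨r, hr⟩ := v.exists_valuation_sub_lt_of_integer hs'
        (Units.mk0 (WithZero.exp (-(m : ℤ))) WithZero.exp_ne_zero)
      exact ⟨r, fun _ => (nrm_le_inv_pow_iff v _ m).2 hr.le⟩
    · exact ⟨0, fun h => absurd h hs⟩
  choose r hr using key
  refine ⟨fun s => Ideal.Quotient.mk _ (r s), fun s s' hs hs' h => ?_⟩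
  have h1 := (nrm_integer_le_inv_pow_iff v _ m).2 (Ideal.Quotient.eq.1 h)
  have : s - s' = ((r s - r s' : 𝓞 k) : k) - ((r s : k) - s) + ((r s' : k) - s') := by
    push_cast
    ring
  rw [this]
  exact nrm_add_le_of_le v (nrm_sub_le_of_le v h1 (hr s hs)) (hr s' hs')

theorem card_quotient_pow (m : ℕ) :
    Nat.card (𝓞 k ⧸ v.asIdeal ^ m) = Ideal.absNorm v.asIdeal ^ m := by
  rw [← map_pow, Ideal.absNorm_apply, Submodule.cardQuot_apply]



theorem exists_perm_apply {i j : Fin 3} (h : i ≠ j) :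
    ∃ σ : Equiv.Perm (Fin 3), σ 0 = i ∧ σ 2 = j := by
  revert i j
  decide

theorem nrm_det_le_one {M : Matrix (Fin 3) (Fin 3) k} (h : ∀ i j, nrm (.inr v) (M i j) ≤ 1) :
    nrm (.inr v) M.det ≤ 1 := by
  have hm : ∀ a b c d e f, nrm (.inr v) (M a b * M c d * M e f) ≤ 1 := fun a b c d e f => by
    simpa using nrm_mul_le_of_le v (nrm_mul_le_of_le v (h a b) (h c d)) (h e f)
  rw [Matrix.det_fin_three]
  exact nrm_sub_le_of_le v (nrm_add_le_of_le v (nrm_add_le_of_le v (nrm_sub_le_of_le v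
    (nrm_sub_le_of_le v (hm _ _ _ _ _ _) (hm _ _ _ _ _ _)) (hm _ _ _ _ _ _))
    (hm _ _ _ _ _ _)) (hm _ _ _ _ _ _)) (hm _ _ _ _ _ _)

/-- At a prime of good reduction, some partial derivative at an integral point is a unit. -/
theorem exists_nrm_mulVec_eq_one {F : Matrix (Fin 3) (Fin 3) k}
    (hint : ∀ i j, nrm (.inr v) (F i j) ≤ 1) (hdet : nrm (.inr v) F.det = 1) {u : Fin 3 → k}
    (hle : ∀ i, nrm (.inr v) (u i) ≤ 1) {i : Fin 3} (hi : u i = 1) (hQ : bil F u u = 0) :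
    ∃ j, i ≠ j ∧ nrm (.inr v) (F.mulVec u j) = 1 := by
  have hFu : ∀ j, nrm (.inr v) (F.mulVec u j) ≤ 1 := fun j => by
    simp only [Matrix.mulVec, dotProduct, Fin.sum_univ_three]
    have hm : ∀ i, nrm (.inr v) (F j i * u i) ≤ 1 := fun i => by
      simpa using nrm_mul_le_of_le v (hint j i) (hle i)
    exact nrm_add_le_of_le v (nrm_add_le_of_le v (hm 0) (hm 1)) (hm 2)
  by_contra! hcon
  have hlt : ∀ j, i ≠ j → nrm (.inr v) (F.mulVec u j) < 1 := fun j hj =>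
    (hFu j).lt_of_ne (hcon j hj)
  have hsmall : ∀ j, nrm (.inr v) (F.mulVec u j) < 1 := by
    intro j
    by_cases hj : i = j
    · subst hj
      have hbil : bil F u u = ∑ j, u j * F.mulVec u j := by
        simp only [bil, Matrix.mulVec, dotProduct, Finset.mul_sum]
        exact Finset.sum_congr rfl fun _ _ => Finset.sum_congr rfl fun _ _ => by ring
      rw [hbil, ← Finset.add_sum_erase _ _ (Finset.mem_univ i), hi, one_mul] at hQ
      rw [eq_neg_of_add_eq_zero_left hQ, nrm_neg]
      refine Finset.sum_induction _ (fun z => nrm (.inr v) z < 1)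
        (fun a b ha hb => (nrm_add_le v a b).trans_lt (max_lt ha hb)) (by simp) fun j hj => ?_
      rw [map_mul]
      exact mul_lt_one_of_nonneg_of_lt_one_right (hle j) (nrm_nonneg _ _)
        (hlt j (Finset.ne_of_mem_erase hj).symm)
    · exact hlt j hj
  have hadj : ∀ r j, nrm (.inr v) (F.adjugate r j) ≤ 1 := fun r j => by
    rw [Matrix.adjugate_apply]
    refine nrm_det_le_one v fun p q => ?_
    rw [Matrix.updateRow_apply]
    split_ifs
    · by_cases h : q = r
      · subst h; simp
      · simp [Pi.single_eq_of_ne h]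
    · exact hint p q
  have hcr : F.det * u i = ∑ j, F.adjugate i j * F.mulVec u j := by
    have h1 : (F.adjugate * F).mulVec u = F.adjugate.mulVec (F.mulVec u) := by
      rw [Matrix.mulVec_mulVec]
    rw [Matrix.adjugate_mul, Matrix.smul_mulVec, Matrix.one_mulVec] at h1
    exact congrFun h1 i
  have hlt1 : nrm (.inr v) (F.det * u i) < 1 := by
    rw [hcr]
    refine Finset.sum_induction _ (fun z => nrm (.inr v) z < 1)
      (fun a b ha hb => (nrm_add_le v a b).trans_lt (max_lt ha hb)) (by simp) fun j _ => ?_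
    rw [map_mul]
    exact mul_lt_one_of_nonneg_of_lt_one_right (hadj i j) (nrm_nonneg _ _) (hsmall j)
  rw [hi, mul_one, hdet] at hlt1
  exact lt_irrefl _ hlt1

end Residues

section ConicCount

variable (v : HeightOneSpectrum (𝓞 k))

theorem bil_smul_smul {F : Matrix (Fin 3) (Fin 3) k} (c : k) (x : Fin 3 → k) :
    bil F (fun i => c * x i) (fun i => c * x i) = c ^ 2 * bil F x x := by
  simp only [bil, Fin.sum_univ_three]
  ring

theorem bil_perm {F : Matrix (Fin 3) (Fin 3) k} (σ : Equiv.Perm (Fin 3)) (x : Fin 3 → k) :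
    bil (F.submatrix σ σ) (x ∘ σ) (x ∘ σ) = bil F x x := by
  simp only [bil, Matrix.submatrix_apply, Function.comp_apply]
  rw [Equiv.sum_comp σ (fun i => ∑ j, F i (σ j) * x i * x (σ j))]
  exact Finset.sum_congr rfl fun i _ => Equiv.sum_comp σ (fun j => F i j * x i * x j)

/-- The data attached to a vector: a normalization by a permutation of the coordinates. -/
theorem exists_normalization {F : Matrix (Fin 3) (Fin 3) k}
    (hint : ∀ i j, nrm (.inr v) (F i j) ≤ 1) (hdet : nrm (.inr v) F.det = 1) {x : Fin 3 → k}
    (hx : x ≠ 0) (hQ : bil F x x = 0) :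
    ∃ σ : Equiv.Perm (Fin 3), x (σ 0) ≠ 0 ∧ nrm (.inr v) (x (σ 0)) = vmax (.inr v) x ∧
      nrm (.inr v) ((F.submatrix σ σ).mulVec (fun i => (x (σ 0))⁻¹ * x (σ i)) 2) = 1 := by
  obtain ⟨i, hi⟩ := exists_vmax_eq (.inr v) x
  have hxi : x i ≠ 0 := fun h => (vmax_pos (.inr v) hx).ne' (by rw [hi, h, map_zero])
  have hle : ∀ j, nrm (.inr v) ((x i)⁻¹ * x j) ≤ 1 := fun j => by
    rw [map_mul, map_inv₀, ← hi, inv_mul_le_one₀ (vmax_pos _ hx)]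
    exact nrm_le_vmax _ x j
  obtain ⟨j, hij, hj⟩ := exists_nrm_mulVec_eq_one v hint hdet
    (u := fun j => (x i)⁻¹ * x j) (i := i) hle (inv_mul_cancel₀ hxi)
    (by rw [bil_smul_smul, hQ, mul_zero])
  obtain ⟨σ, h0, h2⟩ := exists_perm_apply hij
  refine ⟨σ, by rwa [h0], by rw [h0, hi], ?_⟩
  rw [← hj, ← h2, h0]
  congr 1
  simp only [Matrix.mulVec, dotProduct, Matrix.submatrix_apply]
  exact Equiv.sum_comp σ (fun r => F (σ 2) r * ((x i)⁻¹ * x r))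

theorem det3_eq_det {K : Type*} [Field K] (M : Matrix (Fin 3) (Fin 3) K) :
    det3 (M 0) (M 1) (M 2) = M.det := by
  rw [Matrix.det_fin_three, det3]
  ring

theorem nrm_det3_perm (σ : Equiv.Perm (Fin 3)) (M : Matrix (Fin 3) (Fin 3) k) :
    nrm (.inr v) (det3 (M 0 ∘ σ) (M 1 ∘ σ) (M 2 ∘ σ)) =
      nrm (.inr v) (det3 (M 0) (M 1) (M 2)) := by
  have h := det3_eq_det (M.submatrix id σ)
  rw [Matrix.det_permute', ← det3_eq_det M] at h
  change nrm (.inr v) (det3 (M.submatrix id σ 0) (M.submatrix id σ 1) (M.submatrix id σ 2)) = _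
  rw [h]
  rcases Int.units_eq_one_or (Equiv.Perm.sign σ) with hs | hs
  · simp [hs]
  · simp [hs, nrm_neg]

theorem det3_smul {K : Type*} [Field K] (c : Fin 3 → K) (u : Fin 3 → Fin 3 → K) :
    det3 (fun i => c 0 * u 0 i) (fun i => c 1 * u 1 i) (fun i => c 2 * u 2 i) =
      c 0 * c 1 * c 2 * det3 (u 0) (u 1) (u 2) := by
  simp only [det3]
  ring

theorem finite_and_card_le {ι κ : Type} [Finite κ] (φ : ι → κ)
    (h : ∀ p : Fin 3 → ι, Function.Injective p → ¬ (φ (p 0) = φ (p 1) ∧ φ (p 0) = φ (p 2))) :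
    Finite ι ∧ Nat.card ι ≤ 2 * Nat.card κ := by
  classical
  have key : ∀ T : Finset ι, T.card ≤ 2 * Nat.card κ := by
    intro T
    have := Fintype.ofFinite κ
    have h1 : T.card ≤ 2 * (T.image φ).card := by
      refine Finset.card_le_mul_card_image T 2 fun b _ => ?_
      by_contra! hlt
      obtain ⟨p, q, r, hp, hq, hr, hpq, hpr, hqr⟩ := Finset.two_lt_card_iff.1 hlt
      simp only [Finset.mem_filter] at hp hq hr
      refine h ![p, q, r] ?_ ⟨hp.2.trans hq.2.symm, hp.2.trans hr.2.symm⟩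
      intro i j hij
      fin_cases i <;> fin_cases j <;> simp_all
    refine h1.trans (Nat.mul_le_mul_left 2 ?_)
    rw [Nat.card_eq_fintype_card]
    exact Finset.card_le_univ _
  have hfin : Finite ι := by
    by_contra hinf
    rw [not_finite_iff_infinite] at hinf
    obtain ⟨T, hT⟩ := Infinite.exists_subset_card_eq ι (2 * Nat.card κ + 1)
    have := key T
    omega
  refine ⟨hfin, ?_⟩
  have := Fintype.ofFinite ι
  rw [Nat.card_eq_fintype_card]
  exact key Finset.univ

/-- Points on a conic with good reduction at `v`, no three of which are `v`-adically too close,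
are few. -/
theorem card_conic_le {F : Matrix (Fin 3) (Fin 3) k} (hF : ∀ i j, F i j = F j i)
    (hint : ∀ i j, nrm (.inr v) (F i j) ≤ 1) (hdet : nrm (.inr v) F.det = 1)
    (h2 : nrm (.inr v) 2 = 1) {m : ℕ} (hm : 1 ≤ m) {ι : Type} (x : ι → Fin 3 → k)
    (hx : ∀ p, x p ≠ 0) (hQ : ∀ p, bil F (x p) (x p) = 0)
    (hno : ∀ p : Fin 3 → ι, Function.Injective p →
      ¬ nrm (.inr v) (det3 (x (p 0)) (x (p 1)) (x (p 2))) ≤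
        (((Ideal.absNorm v.asIdeal : ℝ) ^ m)⁻¹) ^ 3 *
          (vmax (.inr v) (x (p 0)) * vmax (.inr v) (x (p 1)) * vmax (.inr v) (x (p 2)))) :
    Finite ι ∧ Nat.card ι ≤ 12 * Ideal.absNorm v.asIdeal ^ (m + 1) := by
  choose σ h0 hσ hd using fun p => exists_normalization v hint hdet (hx p) (hQ p)
  set u : ι → Fin 3 → k := fun p i => (x p (σ p 0))⁻¹ * x p (σ p i) with hu
  obtain ⟨ρ, hρ⟩ := exists_residue v m
  obtain ⟨ρ', hρ'⟩ := exists_residue v 1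
  have hq := one_lt_absNorm_real v
  have hfin : ∀ r : ℕ, Finite (𝓞 k ⧸ v.asIdeal ^ r) := fun r =>
    Nat.finite_of_card_ne_zero (by
      rw [card_quotient_pow]
      exact pow_ne_zero _ (by rintro h; rw [h] at hq; norm_num at hq))
  have := hfin m
  have := hfin 1
  have hule : ∀ p i, nrm (.inr v) (u p i) ≤ 1 := fun p i => by
    simp only [hu]
    rw [map_mul, map_inv₀, hσ, inv_mul_le_one₀ (vmax_pos _ (hx p))]
    exact nrm_le_vmax _ _ _
  have hcard := finite_and_card_le (fun p => (σ p, ρ (u p 1), ρ' (u p 2))) ?_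
  · refine ⟨hcard.1, hcard.2.trans_eq ?_⟩
    rw [Nat.card_prod, Nat.card_prod, card_quotient_pow, card_quotient_pow, Nat.card_perm,
      Nat.card_fin]
    simp only [Nat.factorial]
    ring
  intro p hp hcode
  simp only [Prod.mk.injEq] at hcode
  obtain ⟨⟨hs1, hr1, ht1⟩, hs2, hr2, ht2⟩ := hcode
  have hs : ∀ r, σ (p r) = σ (p 0) := by
    intro r; fin_cases r
    exacts [rfl, hs1.symm, hs2.symm]
  have hr : ∀ r, ρ (u (p r) 1) = ρ (u (p 0) 1) := by
    intro r; fin_cases r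
    exacts [rfl, hr1.symm, hr2.symm]
  have ht : ∀ r, ρ' (u (p r) 2) = ρ' (u (p 0) 2) := by
    intro r; fin_cases r
    exacts [rfl, ht1.symm, ht2.symm]
  set τ := σ (p 0) with hτ
  refine hno p hp ?_
  have hpow : ((Ideal.absNorm v.asIdeal : ℝ) ^ m)⁻¹ < 1 :=
    inv_lt_one_of_one_lt₀ (one_lt_pow₀ hq (by omega))
  have hmain := nrm_det3_normalized v (F := F.submatrix τ τ) (fun i j => hF _ _)
    (fun i j => hint _ _) h2 (fun r => u (p r)) (fun r => inv_mul_cancel₀ (h0 _))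
    (fun r i => hule _ _) (fun r => ?_) (fun r => ?_) hpow
    (fun r s => hρ _ _ (hule _ _) (hule _ _) ((hr r).trans (hr s).symm))
    (fun r s => (hρ' _ _ (hule _ _) (hule _ _) ((ht r).trans (ht s).symm)).trans_lt (by
      rw [pow_one]; exact inv_lt_one_of_one_lt₀ hq))
  · have e1 := nrm_det3_perm v τ (Matrix.of fun r => x (p r))
    have e2 : ∀ r, (Matrix.of fun r => x (p r)) r ∘ τ =
        fun i => x (p r) (τ 0) * u (p r) i := fun r => by
      funext i
      have : x (p r) (τ 0) ≠ 0 := by rw [← hs r]; exact h0 _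
      simp only [hu, Matrix.of_apply, Function.comp_apply, hs]
      rw [mul_inv_cancel_left₀ this]
    rw [e2, e2, e2, det3_smul (fun r => x (p r) (τ 0)) (fun r => u (p r))] at e1
    change _ = nrm (.inr v) (det3 (x (p 0)) (x (p 1)) (x (p 2))) at e1
    rw [← e1, map_mul, map_mul, map_mul, mul_comm]
    have e3 : ∀ r, nrm (.inr v) (x (p r) (τ 0)) = vmax (.inr v) (x (p r)) := fun r => by
      rw [← hσ (p r), hs r]
    rw [e3, e3, e3]
    exact mul_le_mul_of_nonneg_right hmain (mul_nonneg (mul_nonneg (vmax_nonneg _ _)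
      (vmax_nonneg _ _)) (vmax_nonneg _ _))
  · have e2 : u (p r) = fun i => (x (p r) (σ (p r) 0))⁻¹ * (x (p r) ∘ τ) i := by
      funext i
      simp only [hu, Function.comp_apply, hs]
    rw [e2, bil_smul_smul, bil_perm, hQ, mul_zero]
  · have := hd (p r)
    rw [hs] at this
    change nrm (.inr v) ((F.submatrix τ τ).mulVec
      (fun i => (x (p r) (σ (p r) 0))⁻¹ * x (p r) (σ (p r) i)) 2) = 1
    rw [hs]
    exact this

end ConicCount

section GlobalDeterminant

/-- The factor by which the triangle inequality for `N` terms fails to be ultrametric. -/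
def archFactor (N : ℕ) : Place k → ℝ
  | .inl w => (N : ℝ) ^ w.mult
  | .inr _ => 1

theorem eventually_archFactor_eq_one (N : ℕ) :
    ∀ᶠ v : Place k in cofinite, archFactor N v = 1 := by
  refine (Set.finite_range (Sum.inl : InfinitePlace k → Place k)).subset ?_
  rintro (w | v) hv
  · exact ⟨w, rfl⟩
  · exact absurd rfl hv

theorem finprod_archFactor (N : ℕ) :
    ∏ᶠ v : Place k, archFactor N v = (N : ℝ) ^ Module.finrank ℚ k := by
  rw [finprod_sumType (eventually_archFactor_eq_one N)]
  simp only [archFactor, finprod_one, mul_one]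
  rw [Finset.prod_pow_eq_pow_sum, InfinitePlace.sum_mult_eq]

theorem archFactor_nonneg (N : ℕ) (v : Place k) : 0 ≤ archFactor N v := by
  rcases v with w | v
  · simp only [archFactor]; positivity
  · simp [archFactor]

theorem nrm_sum_le {ι : Type*} (v : Place k) {s : Finset ι} {τ : ι → k} {c : ℝ}
    (hc : 0 ≤ c) (h : ∀ i ∈ s, nrm v (τ i) ≤ c) :
    nrm v (∑ i ∈ s, τ i) ≤ archFactor s.card v * c := by
  rcases s.eq_empty_or_nonempty with rfl | hs
  · simpa using mul_nonneg (archFactor_nonneg _ v) hc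
  rcases v with w | v
  · obtain ⟨i, hi, hmax⟩ := s.exists_max_image (fun i => w (τ i)) hs
    have h1 : w (∑ i ∈ s, τ i) ≤ s.card * w (τ i) := by
      refine (w.1.sum_le s τ).trans ?_
      rw [← nsmul_eq_mul]
      exact Finset.sum_le_card_nsmul s _ _ hmax
    rw [nrm_inl, archFactor]
    calc w (∑ i ∈ s, τ i) ^ w.mult ≤ (s.card * w (τ i)) ^ w.mult :=
          pow_le_pow_left₀ (apply_nonneg _ _) h1 _
      _ ≤ (s.card : ℝ) ^ w.mult * c := by
          rw [mul_pow]
          exact mul_le_mul_of_nonneg_left (h i hi) (by positivity)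
  · simp only [archFactor, one_mul]
    refine Finset.sum_induction _ (fun z => nrm (.inr v) z ≤ c)
      (fun a b ha hb => nrm_add_le_of_le v ha hb) (by simpa using hc) h

theorem nrm_neg_place (v : Place k) (z : k) : nrm v (-z) = nrm v z := by
  rcases v with w | v
  · exact congrArg (· ^ w.mult) (w.1.map_neg z)
  · exact nrm_neg v z

theorem nrm_det3_le (a : Fin 3 → ℤ) (v : Place k) {ι : Type} [Fintype ι] [Nonempty ι] {y : ι → k}
    (hy : y ≠ 0) (x : Fin 3 → Fin 3 → k) :
    nrm v (det3 (x 0) (x 1) (x 2)) ≤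
      archFactor 6 v * (vmax v y ^ (-(a 0 + a 1 + a 2)) * ∏ r, vmaxTw a v y (x r)) := by
  have hY := vmax_pos v hy
  have hx : ∀ r j, nrm v (x r j) ≤ vmaxTw a v y (x r) * vmax v y ^ (-(a j)) := fun r j => by
    rw [zpow_neg, ← div_eq_mul_inv, le_div_iff₀ (zpow_pos hY _), mul_comm]
    exact le_vmaxTw a v y (x r) j
  rw [show det3 (x 0) (x 1) (x 2) = _ from det3_eq_det (Matrix.of x), Matrix.det_apply]
  have h6 : (Finset.univ : Finset (Equiv.Perm (Fin 3))).card = 6 := by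
    rw [Finset.card_univ, Fintype.card_perm, Fintype.card_fin]; rfl
  rw [← h6]
  refine nrm_sum_le v (mul_nonneg (zpow_nonneg hY.le _)
    (Finset.prod_nonneg fun r _ => vmaxTw_nonneg a v y (x r))) fun σ _ => ?_
  have h1 : nrm v (Equiv.Perm.sign σ • ∏ i, Matrix.of x (σ i) i) = ∏ i, nrm v (x (σ i) i) := by
    rw [← map_prod]
    rcases Int.units_eq_one_or (Equiv.Perm.sign σ) with hs | hs
    · simp [hs]
    · simp [hs, nrm_neg_place]
  rw [h1]
  calc ∏ i, nrm v (x (σ i) i) ≤ ∏ i, vmaxTw a v y (x (σ i)) * vmax v y ^ (-(a i)) :=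
        Finset.prod_le_prod (fun i _ => nrm_nonneg v _) fun i _ => hx _ _
    _ = _ := by
        rw [Finset.prod_mul_distrib, Equiv.prod_comp σ (fun r => vmaxTw a v y (x r)), mul_comm,
          Fin.prod_univ_three (fun i => vmax v y ^ (-(a i))), ← zpow_add₀ hY.ne',
          ← zpow_add₀ hY.ne']
        congr 2
        ring

/-- The product formula applied to the determinant of three vectors, with extra information at
one finite place. -/
theorem one_le_of_det3_ne_zero (a : Fin 3 → ℤ) {ι : Type} [Fintype ι] [Nonempty ι] {y : ι → k}
    (hy : y ≠ 0) {x : Fin 3 → Fin 3 → k} (hx : ∀ r, x r ≠ 0)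
    (hdet : det3 (x 0) (x 1) (x 2) ≠ 0) {v₀ : HeightOneSpectrum (𝓞 k)}
    (hy₀ : vmax (.inr v₀) y = 1) {c : ℝ}
    (hloc : nrm (.inr v₀) (det3 (x 0) (x 1) (x 2)) ≤
      c * (vmax (.inr v₀) (x 0) * vmax (.inr v₀) (x 1) * vmax (.inr v₀) (x 2))) :
    1 ≤ 6 ^ Module.finrank ℚ k *
      (c * (ht y ^ (-(a 0 + a 1 + a 2)) * ∏ r, htTw a y (x r))) := by
  classical
  set δ : Place k → ℝ := fun v => if v = .inr v₀ then c else 1 with hδ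
  have hδ1 : ∀ v, v ≠ .inr v₀ → δ v = 1 := fun v hv => if_neg hv
  have eδ : ∀ᶠ v : Place k in cofinite, δ v = 1 := by
    refine (Set.finite_singleton (Sum.inr v₀ : Place k)).subset fun v hv => ?_
    by_contra h
    exact hv (hδ1 v h)
  have eA := eventually_archFactor_eq_one (k := k) 6
  have eY := eventually_zpow_eq_one hy (-(a 0 + a 1 + a 2))
  have eG := fun r => eventually_vmaxTw_eq_one a hy (hx r)
  have eP : ∀ᶠ v : Place k in cofinite, ∏ r, vmaxTw a v y (x r) = 1 := by
    filter_upwards [eventually_all.2 eG] with v hv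
    exact Finset.prod_eq_one fun r _ => hv r
  have eYP : ∀ᶠ v : Place k in cofinite,
      vmax v y ^ (-(a 0 + a 1 + a 2)) * ∏ r, vmaxTw a v y (x r) = 1 := by
    filter_upwards [eY, eP] with v h h'
    rw [h, h', mul_one]
  have eδYP : ∀ᶠ v : Place k in cofinite,
      δ v * (vmax v y ^ (-(a 0 + a 1 + a 2)) * ∏ r, vmaxTw a v y (x r)) = 1 := by
    filter_upwards [eδ, eYP] with v h h'
    rw [h, h', mul_one]
  have eall : ∀ᶠ v : Place k in cofinite, archFactor 6 v *
      (δ v * (vmax v y ^ (-(a 0 + a 1 + a 2)) * ∏ r, vmaxTw a v y (x r))) = 1 := by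
    filter_upwards [eA, eδYP] with v h h'
    rw [h, h', mul_one]
  have hprod : ∏ᶠ v : Place k, ∏ r, vmaxTw a v y (x r) = ∏ r, htTw a y (x r) := by
    simp only [Fin.prod_univ_three]
    rw [finprod_mul_of_eventually _ (eG 2), finprod_mul_of_eventually (eG 0) (eG 1)]
    · rfl
    · filter_upwards [eG 0, eG 1] with v h h'
      rw [h, h', mul_one]
  calc (1 : ℝ) = ∏ᶠ v : Place k, nrm v (det3 (x 0) (x 1) (x 2)) := (finprod_nrm hdet).symm
    _ ≤ ∏ᶠ v : Place k, archFactor 6 v *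
        (δ v * (vmax v y ^ (-(a 0 + a 1 + a 2)) * ∏ r, vmaxTw a v y (x r))) := by
      refine finprod_le_finprod_of_eventually (eventually_nrm_eq_one hdet) eall
        (fun v => nrm_nonneg v _) fun v => ?_
      by_cases hv : v = .inr v₀
      · subst hv
        simpa [hδ, hy₀, archFactor, Fin.prod_univ_three, vmaxTw_of_vmax_eq_one a hy₀] using hloc
      · rw [hδ1 v hv, one_mul]
        exact nrm_det3_le a v hy x
    _ = _ := by
      rw [finprod_mul_of_eventually eA eδYP, finprod_mul_of_eventually eδ eYP,
        finprod_mul_of_eventually eY eP, finprod_archFactor, ht_zpow hy, hprod,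
        finprod_eq_single δ (.inr v₀) hδ1]
      simp [hδ]

end GlobalDeterminant

section FibreCount

/-- Uniform upper bound for the number of points of bounded height on a conic. -/
theorem card_fibre_le {a : Fin 3 → ℤ} (ha : a 0 ≤ a 1 ∧ a 1 ≤ a 2) {y : Fin (n + 1) → k}
    (hy : y ≠ 0) {v : HeightOneSpectrum (𝓞 k)} (hyv : vmax (.inr v) y = 1)
    {F : Matrix (Fin 3) (Fin 3) k} (hF : ∀ i j, F i j = F j i)
    (hint : ∀ i j, nrm (.inr v) (F i j) ≤ 1) (hdet : nrm (.inr v) F.det = 1)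
    (h2 : nrm (.inr v) 2 = 1) {T : ℝ} {ι : Type} (x : ι → Fin 3 → k)
    (hx : ∀ p, x p 2 ≠ 0) (hQ : ∀ p, bil F (x p) (x p) = 0)
    (hprop : ∀ p r, p ≠ r → ¬ ∃ c, ∀ i, x r i = c * x p i)
    (hT : ∀ p, htTw a y (x p) ≤ T) (hT0 : 0 ≤ T) :
    Finite ι ∧ (Nat.card ι : ℝ) ≤ 12 * (Ideal.absNorm v.asIdeal : ℝ) ^ 2 *
      (6 ^ Module.finrank ℚ k * T * ht y ^ (-(((a 0 + a 1 + a 2 : ℤ) : ℝ) / 3))) := by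
  have hh := one_le_ht hy
  have hh0 : 0 < ht y := one_pos.trans_le hh
  set d := Module.finrank ℚ k
  set q : ℝ := (Ideal.absNorm v.asIdeal : ℝ) with hq
  have hq1 : 1 < q := one_lt_absNorm_real v
  rcases isEmpty_or_nonempty ι with hι | ⟨⟨p₀⟩⟩
  · exact ⟨inferInstance, by rw [Nat.card_of_isEmpty, Nat.cast_zero]; positivity⟩
  set Z := 6 ^ d * T * ht y ^ (-(((a 0 + a 1 + a 2 : ℤ) : ℝ) / 3)) with hZ
  have h6 : (1 : ℝ) ≤ 6 ^ d := one_le_pow₀ (by norm_num)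
  have hT1 : ht y ^ (((a 0 + a 1 + a 2 : ℤ) : ℝ) / 3) ≤ T := by
    refine le_trans ?_ ((ht_zpow_le_htTw a hy (hx p₀)).trans (hT p₀))
    rw [← Real.rpow_intCast]
    refine Real.rpow_le_rpow_of_exponent_le hh ?_
    have h1 : (a 0 : ℝ) ≤ a 1 := mod_cast ha.1
    have h2 : (a 1 : ℝ) ≤ a 2 := mod_cast ha.2
    push_cast
    linarith
  have hZ1 : 1 ≤ Z := by
    rw [hZ, mul_assoc]
    refine one_le_mul_of_one_le_of_one_le h6 ?_
    rw [Real.rpow_neg hh0.le, ← div_eq_mul_inv, one_le_div (by positivity)]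
    exact hT1
  obtain ⟨m, hm, hm'⟩ := exists_nat_pow_near hZ1 hq1
  have hx0 : ∀ p, x p ≠ 0 := fun p h => hx p (by simp [h])
  have h2k : (2 : k) ≠ 0 := two_ne_zero
  have hdet0 : F.det ≠ 0 := fun h => by simp [h] at hdet
  have hcon := card_conic_le v hF hint hdet h2 (m := m + 1) (by omega) x hx0 hQ ?_
  · obtain ⟨hfin, hcard⟩ := hcon
    refine ⟨hfin, ?_⟩
    calc (Nat.card ι : ℝ) ≤ ((12 * Ideal.absNorm v.asIdeal ^ (m + 1 + 1) : ℕ) : ℝ) :=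
          mod_cast hcard
      _ = 12 * q ^ 2 * q ^ m := by push_cast; ring
      _ ≤ 12 * q ^ 2 * Z := by gcongr
  intro p hp hle
  have hne : ∀ i j, i ≠ j → p i ≠ p j := fun i j hij h => hij (hp h)
  have hdet3 := det3_ne_zero hF hdet0 h2k (hx0 (p 0)) (hx0 (p 1)) (hQ (p 0)) (hQ (p 1)) (hQ (p 2))
    (hprop _ _ (hne 0 1 (by decide))) (hprop _ _ (hne 0 2 (by decide)))
    (hprop _ _ (hne 1 2 (by decide)))
  have hglob := one_le_of_det3_ne_zero a hy (x := fun r => x (p r)) (fun r => hx0 _) hdet3 hyv hle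
  have hprod : ∏ r, htTw a y (x (p r)) ≤ T ^ 3 := by
    have h0 : ∀ r, 0 ≤ htTw a y (x (p r)) := fun r =>
      (zpow_nonneg hh0.le _).trans (ht_zpow_le_htTw a hy (hx (p r)))
    calc ∏ r, htTw a y (x (p r)) ≤ ∏ _r : Fin 3, T :=
          Finset.prod_le_prod (fun r _ => h0 r) fun r _ => hT _
      _ = T ^ 3 := by simp
  have hZ3 : Z ^ 3 = (6 ^ d) ^ 3 * (ht y ^ (-(a 0 + a 1 + a 2)) * T ^ 3) := by
    rw [hZ, mul_pow, mul_pow, ← Real.rpow_mul_natCast hh0.le, ← Real.rpow_intCast]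
    have : -(((a 0 + a 1 + a 2 : ℤ) : ℝ) / 3) * ((3 : ℕ) : ℝ) = ((-(a 0 + a 1 + a 2) : ℤ) : ℝ) := by
      push_cast
      ring
    rw [this]
    ring
  have h63 : (6 : ℝ) ^ d ≤ (6 ^ d) ^ 3 := le_self_pow₀ h6 three_ne_zero
  have hqm : 0 < q ^ (m + 1) := by positivity
  have hlt : ((q ^ (m + 1))⁻¹) ^ 3 * Z ^ 3 < 1 := by
    rw [← mul_pow]
    refine pow_lt_one₀ (by positivity) ?_ (by norm_num)
    rw [inv_mul_lt_one₀ hqm]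
    exact hm'
  refine absurd hglob (not_le.2 (lt_of_le_of_lt ?_ hlt))
  have hz : 0 ≤ ht y ^ (-(a 0 + a 1 + a 2)) := zpow_nonneg hh0.le _
  have hprod0 : 0 ≤ ∏ r, htTw a y (x (p r)) := Finset.prod_nonneg fun r _ =>
    (zpow_nonneg hh0.le _).trans (ht_zpow_le_htTw a hy (hx (p r)))
  calc 6 ^ d * (((q ^ (m + 1))⁻¹) ^ 3 * (ht y ^ (-(a 0 + a 1 + a 2)) * ∏ r, htTw a y (x (p r))))
      ≤ (6 ^ d) ^ 3 * (((q ^ (m + 1))⁻¹) ^ 3 * (ht y ^ (-(a 0 + a 1 + a 2)) * T ^ 3)) := by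
        gcongr
    _ = ((q ^ (m + 1))⁻¹) ^ 3 * Z ^ 3 := by rw [hZ3]; ring

end FibreCount

section GoodRepresentative

variable {ι : Type} [Fintype ι] [Nonempty ι]

theorem ht_eq_prod_maxAt {z : ι → k} (hz : z ≠ 0) :
    ht z = (∏ w : InfinitePlace k, maxAt w z ^ w.mult) *
      ∏ᶠ v : FinitePlace k, ⨆ i, v (z i) := by
  rw [ht, finprod_sumType (eventually_vmax_eq_one hz), ← finprod_mk_eq fun v => ⨆ i, v (z i)]
  simp only [maxAt_pow]
  congr 2
  ext v
  rw [vmax, Finset.sup'_univ_eq_ciSup]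
  rfl

theorem absNorm_mul_ht {z : ι → 𝓞 k} (hz : (fun i => (z i : k)) ≠ 0) :
    (Ideal.absNorm (Ideal.span (Set.range z)) : ℝ) * ht (fun i => (z i : k)) =
      ∏ w : InfinitePlace k, maxAt w (fun i => (z i : k)) ^ w.mult := by
  have hz' : z ≠ 0 := by
    rintro rfl
    exact hz (by ext; simp)
  have h := NumberField.absNorm_mul_finprod_finitePlace_eq_one (K := k) hz'
  rw [ht_eq_prod_maxAt hz, mul_left_comm, h, mul_one]

open mixedEmbedding in
theorem exists_integral_rep (k : Type) [Field k] [NumberField k] (ι : Type) [Fintype ι]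
    [Nonempty ι] : ∃ C : ℝ, 1 ≤ C ∧ ∀ y : ι → k, y ≠ 0 → ∃ (l : kˣ) (z : ι → 𝓞 k),
      (∀ i, (z i : k) = l * y i) ∧ ∀ (w : InfinitePlace k) i,
        w (z i) ≤ C * ht y ^ ((Module.finrank ℚ k : ℝ)⁻¹) := by
  classical
  set d := Module.finrank ℚ k with hd
  have hd0 : d ≠ 0 := Module.finrank_pos.ne'
  set M := (MeasureTheory.volume (ZSpan.fundamentalDomain (latticeBasis k)) *
    2 ^ Module.finrank ℝ (mixedSpace k)).toReal with hM
  have hMtop : MeasureTheory.volume (ZSpan.fundamentalDomain (latticeBasis k)) *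
    2 ^ Module.finrank ℝ (mixedSpace k) ≠ ⊤ :=
    ENNReal.mul_ne_top (ZSpan.fundamentalDomain_isBounded _).measure_lt_top.ne
      (ENNReal.pow_ne_top ENNReal.ofNat_ne_top)
  have hM0 : 0 ≤ M := ENNReal.toReal_nonneg
  refine ⟨M + 1, by linarith, fun y hy => ?_⟩
  obtain ⟨b, hb⟩ := IsLocalization.exist_integer_multiples_of_finite (nonZeroDivisors (𝓞 k)) y
  choose z₀ hz₀ using hb
  have hbk : ((b : 𝓞 k) : k) ≠ 0 := by
    simp
  have hz₀' : ∀ i, (z₀ i : k) = ((b : 𝓞 k) : k) * y i := fun i => by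
    rw [← Algebra.smul_def]
    exact hz₀ i
  have hz₀ne : (fun i => (z₀ i : k)) ≠ 0 := by
    obtain ⟨i, hi⟩ := Function.ne_iff.1 hy
    refine Function.ne_iff.2 ⟨i, ?_⟩
    simpa [hz₀'] using hi
  have hht : ht (fun i => (z₀ i : k)) = ht y := by
    simp only [hz₀']
    exact ht_smul hbk hy
  set I := Ideal.span (Set.range z₀) with hI
  have hIne : I ≠ ⊥ := by
    obtain ⟨i, hi⟩ := Function.ne_iff.1 hz₀ne
    intro h
    rw [hI, Ideal.span_eq_bot] at h
    exact hi (by simp [h (z₀ i) ⟨i, rfl⟩])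
  have hIne' : (I : FractionalIdeal (nonZeroDivisors (𝓞 k)) k) ≠ 0 :=
    FractionalIdeal.coeIdeal_ne_zero.2 hIne
  set J : (FractionalIdeal (nonZeroDivisors (𝓞 k)) k)ˣ := (Units.mk0 _ hIne')⁻¹ with hJ
  have hNpos : (0 : ℝ) < Ideal.absNorm I := by
    have : Ideal.absNorm I ≠ 0 := by rwa [Ne, Ideal.absNorm_eq_zero_iff]
    positivity
  have hJnorm : ((FractionalIdeal.absNorm J.1 : ℚ) : ℝ) = (Ideal.absNorm I : ℝ)⁻¹ := by
    rw [hJ, Units.val_inv_eq_inv_val, Units.val_mk0, map_inv₀, FractionalIdeal.coeIdeal_absNorm]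
    simp
  have hh1 : 1 ≤ ht y := one_le_ht hy
  have hh0 : 0 < ht y := one_pos.trans_le hh1
  set t := (M + 1) * ht y ^ ((d : ℝ)⁻¹) with ht_def
  have ht0 : 0 < t := by positivity
  have htd : t ^ d = (M + 1) ^ d * ht y := by
    rw [ht_def, mul_pow, ← Real.rpow_mul_natCast hh0.le, inv_mul_cancel₀ (by exact_mod_cast hd0),
      Real.rpow_one]
  have hm : ∀ w : InfinitePlace k, 0 < maxAt w fun i => (z₀ i : k) := fun w => maxAt_pos w hz₀ne
  obtain ⟨F, hF⟩ : ∃ F : InfinitePlace k → NNReal,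
      ∀ w, (F w : ℝ) = t / maxAt w fun i => (z₀ i : k) :=
    ⟨fun w => (t / maxAt w fun i => (z₀ i : k)).toNNReal, fun w =>
      Real.coe_toNNReal _ (div_pos ht0 (hm w)).le⟩
  have hFprod : ∏ w, ((F w : ℝ)) ^ w.mult = t ^ d / ((Ideal.absNorm I : ℝ) * ht y) := by
    rw [← hht, absNorm_mul_ht hz₀ne]
    simp only [hF, div_pow]
    rw [Finset.prod_div_distrib, Finset.prod_pow_eq_pow_sum, InfinitePlace.sum_mult_eq]
  have hlt : minkowskiBound k J < MeasureTheory.volume (convexBodyLT k F) := by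
    rw [minkowskiBound, volume_fundamentalDomain_fractionalIdealLatticeBasis, convexBodyLT_volume,
      ENNReal.ofNNReal_finsetProd, mul_assoc, hJnorm, ← ENNReal.ofReal_toReal hMtop, ← hM]
    have h2 : (∏ w, ((F w ^ w.mult : NNReal) : ENNReal)) =
        ENNReal.ofReal (t ^ d / ((Ideal.absNorm I : ℝ) * ht y)) := by
      rw [← hFprod, ENNReal.ofReal_prod_of_nonneg fun w _ => by positivity]
      refine Finset.prod_congr rfl fun w _ => ?_
      rw [ENNReal.ofReal_pow NNReal.zero_le_coe, ENNReal.coe_pow, ENNReal.ofReal_coe_nnreal]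
    rw [h2, ← ENNReal.ofReal_mul (by positivity)]
    calc ENNReal.ofReal ((Ideal.absNorm I : ℝ)⁻¹ * M)
        < ENNReal.ofReal (t ^ d / ((Ideal.absNorm I : ℝ) * ht y)) := by
          rw [ENNReal.ofReal_lt_ofReal_iff (by positivity), htd]
          have : (M + 1) ^ d * ht y / ((Ideal.absNorm I : ℝ) * ht y) =
              (Ideal.absNorm I : ℝ)⁻¹ * (M + 1) ^ d := by
            field_simp
          rw [this]
          gcongr
          calc M < M + 1 := by linarith
            _ ≤ (M + 1) ^ d := le_self_pow₀ (by linarith) hd0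
      _ ≤ _ := by
          refine le_mul_of_one_le_left (by positivity) ?_
          exact_mod_cast one_le_convexBodyLTFactor k
  obtain ⟨x, hxJ, hx0, hxlt⟩ := exists_ne_zero_mem_ideal_lt k J hlt
  have hmem : ∀ i, ∃ r : 𝓞 k, (r : k) = x * z₀ i := fun i => by
    rw [hJ, Units.val_inv_eq_inv_val, Units.val_mk0, FractionalIdeal.mem_inv_iff hIne'] at hxJ
    have := hxJ (z₀ i) (FractionalIdeal.mem_coeIdeal_of_mem _ (Ideal.subset_span ⟨i, rfl⟩))
    obtain ⟨r, hr⟩ := (FractionalIdeal.mem_one_iff _).1 this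
    exact ⟨r, hr⟩
  choose z hz using hmem
  refine ⟨Units.mk0 (x * ((b : 𝓞 k) : k)) (mul_ne_zero hx0 hbk), z, fun i => ?_, fun w i => ?_⟩
  · rw [hz, hz₀', Units.val_mk0, mul_assoc]
  · rw [hz, map_mul]
    calc w x * w (z₀ i) ≤ (F w : ℝ) * maxAt w fun i => (z₀ i : k) := by
          gcongr
          · exact (hxlt w).le
          · exact le_maxAt w (fun i => (z₀ i : k)) i
      _ = t := by rw [hF]; exact div_mul_cancel₀ _ (hm w).ne'

end GoodRepresentative

section Summability

open mixedEmbedding in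
theorem summable_rpow_of_le {ι Q : Type} [Fintype ι] (z : Q → ι → 𝓞 k)
    (hz : Function.Injective z) (hz0 : ∀ q, z q ≠ 0) {R : Q → ℝ}
    (hR : ∀ q (w : InfinitePlace k) i, w (z q i) ≤ R q) (hR0 : ∀ q, 0 < R q) {r : ℝ}
    (hr : (Module.finrank ℚ k : ℝ) * Fintype.card ι < r) :
    Summable fun q => R q ^ (-r) := by
  classical
  let b := Pi.basis fun _ : ι => latticeBasis k
  let L := Submodule.span ℤ (Set.range b)
  have hrank : Module.finrank ℤ L = Module.finrank ℚ k * Fintype.card ι := by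
    rw [ZLattice.rank ℝ L, Module.finrank_pi_fintype]
    exact (Finset.sum_congr rfl fun _ _ => mixedEmbedding.finrank k).trans (by simp [mul_comm])
  have hmem : ∀ q, (fun i => mixedEmbedding k (z q i)) ∈ L := fun q => by
    refine (Module.Basis.mem_span_iff_repr_mem ℤ b _).2 fun ji => ?_
    rw [Pi.basis_repr]
    refine (Module.Basis.mem_span_iff_repr_mem ℤ (latticeBasis k) _).1 ?_ ji.2
    rw [mem_span_latticeBasis]
    exact ⟨z q ji.1, rfl⟩
  let φ : Q → L := fun q => ⟨_, hmem q⟩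
  have hφ : Function.Injective φ := fun p q h => hz <| funext fun i => by
    have := congrFun (congrArg Subtype.val h) i
    exact RingOfIntegers.ext (mixedEmbedding_injective k this)
  have hsum := (ZLattice.summable_norm_rpow L (-r) (by
    rw [hrank]; push_cast; linarith)).comp_injective hφ
  refine Summable.of_nonneg_of_le (fun q => Real.rpow_nonneg (hR0 q).le _) (fun q => ?_) hsum
  have hr0 : 0 ≤ r := le_trans (by positivity) hr.le
  refine Real.rpow_le_rpow_of_nonpos ?_ ?_ (by linarith)
  · rw [norm_pos_iff]
    intro h
    refine hz0 q (funext fun i => ?_)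
    have := congrFun (congrArg Subtype.val h) i
    refine RingOfIntegers.ext (mixedEmbedding_injective k (this.trans ?_))
    simp
  · change ‖fun i => mixedEmbedding k (z q i)‖ ≤ R q
    refine (pi_norm_le_iff_of_nonneg (hR0 q).le).2 fun i => ?_
    rw [norm_eq_sup'_normAtPlace]
    refine Finset.sup'_le _ _ fun w _ => ?_
    rw [normAtPlace_apply]
    exact hR q w i

end Summability

section PrimeChoice

theorem pow_le_of_forall_prime_dvd (m : ℕ) {x : ℕ} (hx : x ≠ 0) {N : ℕ} (hN : N ≠ 0)
    (h : ∀ p : ℕ, p.Prime → x < p → p ≤ 2 ^ m * x → p ∣ N) : x ^ m ≤ N := by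
  induction m generalizing N with
  | zero => simpa using Nat.one_le_iff_ne_zero.2 hN
  | succ m ih =>
    have hx' : 2 ^ m * x ≠ 0 := by positivity
    obtain ⟨p, hp, hlt, hle⟩ := Nat.exists_prime_lt_and_le_two_mul _ hx'
    have hxp : x < p := (Nat.le_mul_of_pos_left x (by positivity)).trans_lt hlt
    obtain ⟨M, rfl⟩ := h p hp hxp (hle.trans_eq (by ring))
    have hM : M ≠ 0 := right_ne_zero_of_mul hN
    have := ih hM fun q hq hxq hqle => by
      have hdvd := h q hq hxq (hqle.trans (Nat.mul_le_mul_right x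
        (Nat.pow_le_pow_right two_pos m.le_succ)))
      refine ((Nat.coprime_primes hq hp).2 ?_).dvd_of_dvd_mul_left hdvd
      exact (hqle.trans_lt hlt).ne
    calc x ^ (m + 1) = x * x ^ m := pow_succ' x m
      _ ≤ p * M := Nat.mul_le_mul hxp.le this

theorem exists_prime_not_dvd_le {ε : ℝ} (hε : 0 < ε) :
    ∃ C : ℝ, 0 < C ∧ ∀ N : ℕ, N ≠ 0 → ∃ p : ℕ, p.Prime ∧ ¬ p ∣ N ∧ (p : ℝ) ≤ C * (N : ℝ) ^ ε := by
  obtain ⟨m, hm⟩ := exists_nat_gt ε⁻¹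
  have hm0 : (0 : ℝ) < m := (inv_pos.2 hε).trans hm
  have hmε : (m : ℝ)⁻¹ ≤ ε := (inv_le_comm₀ hm0 hε).2 hm.le
  refine ⟨2 ^ m * 2, by positivity, fun N hN => ?_⟩
  have hN1 : (1 : ℝ) ≤ N := by exact_mod_cast Nat.one_le_iff_ne_zero.2 hN
  set x := ⌊(N : ℝ) ^ ((m : ℝ)⁻¹)⌋₊ + 1 with hx
  have hlt : (N : ℝ) ^ ((m : ℝ)⁻¹) < x := by
    rw [hx]; exact_mod_cast Nat.lt_floor_add_one _
  have hxm : N < x ^ m := by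
    have : ((N : ℝ) ^ ((m : ℝ)⁻¹)) ^ m < (x : ℝ) ^ m :=
      pow_lt_pow_left₀ hlt (by positivity) (by rintro rfl; simp at hm0)
    rw [← Real.rpow_mul_natCast (by positivity), inv_mul_cancel₀ hm0.ne', Real.rpow_one] at this
    exact_mod_cast this
  have hex : ∃ p : ℕ, p.Prime ∧ x < p ∧ p ≤ 2 ^ m * x ∧ ¬ p ∣ N := by
    by_contra! hcon
    exact absurd (pow_le_of_forall_prime_dvd m (by omega) hN hcon) (not_le.2 hxm)
  obtain ⟨p, hp, -, hle, hdvd⟩ := hex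
  refine ⟨p, hp, hdvd, ?_⟩
  have h1 : (1 : ℝ) ≤ (N : ℝ) ^ ε := Real.one_le_rpow hN1 hε.le
  have h2 : (x : ℝ) ≤ 2 * (N : ℝ) ^ ε := by
    have : (x : ℝ) ≤ (N : ℝ) ^ ((m : ℝ)⁻¹) + 1 := by
      rw [hx]; push_cast
      gcongr
      exact Nat.floor_le (by positivity)
    have h3 : (N : ℝ) ^ ((m : ℝ)⁻¹) ≤ (N : ℝ) ^ ε := Real.rpow_le_rpow_of_exponent_le hN1 hmε
    linarith
  calc (p : ℝ) ≤ 2 ^ m * x := by exact_mod_cast hle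
    _ ≤ 2 ^ m * (2 * (N : ℝ) ^ ε) := by gcongr
    _ = _ := by ring

theorem exists_heightOneSpectrum_notMem {p : ℕ} (hp : p.Prime) {θ : 𝓞 k}
    (hpθ : ¬ p ∣ Ideal.absNorm (Ideal.span {θ})) :
    ∃ v : HeightOneSpectrum (𝓞 k), θ ∉ v.asIdeal ∧
      Ideal.absNorm v.asIdeal ≤ p ^ Module.finrank ℚ k := by
  have hnorm : Ideal.absNorm (Ideal.span {(p : 𝓞 k)}) = p ^ Module.finrank ℚ k := by
    rw [Ideal.absNorm_span_natCast, RingOfIntegers.rank]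
  have hd : Module.finrank ℚ k ≠ 0 := Module.finrank_pos.ne'
  have hne : Ideal.span {(p : 𝓞 k)} ≠ ⊤ := fun h => by
    rw [h, Ideal.absNorm_top] at hnorm
    exact (Nat.one_lt_pow hd hp.one_lt).ne hnorm
  obtain ⟨P, hP, hle⟩ := Ideal.exists_le_maximal _ hne
  have hdvd : Ideal.absNorm P ∣ p ^ Module.finrank ℚ k :=
    hnorm ▸ Ideal.absNorm_dvd_absNorm_of_le hle
  have hP0 : P ≠ ⊥ := by
    rintro rfl
    have : (p : 𝓞 k) = 0 := by simpa using hle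
    exact hp.ne_zero (by exact_mod_cast this)
  refine ⟨⟨P, hP.isPrime, hP0⟩, fun hθ => hpθ ?_, Nat.le_of_dvd (pow_pos hp.pos _) hdvd⟩
  have h1 : Ideal.absNorm P ∣ Ideal.absNorm (Ideal.span {θ}) :=
    Ideal.absNorm_dvd_absNorm_of_le ((Ideal.span_singleton_le_iff_mem _).2 hθ)
  obtain ⟨i, -, hi⟩ := (Nat.dvd_prime_pow hp).1 hdvd
  refine dvd_trans ?_ h1
  rw [hi]
  refine dvd_pow_self p ?_
  rintro rfl
  exact hP.ne_top (Ideal.absNorm_eq_one_iff.1 (by simpa using hi))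

variable (k) in
theorem exists_notMem_absNorm_le {ε : ℝ} (hε : 0 < ε) :
    ∃ C : ℝ, 0 < C ∧ ∀ θ : 𝓞 k, θ ≠ 0 → ∃ v : HeightOneSpectrum (𝓞 k), θ ∉ v.asIdeal ∧
      (Ideal.absNorm v.asIdeal : ℝ) ≤ C * (∏ w : InfinitePlace k, w θ ^ w.mult) ^ ε := by
  have hd : Module.finrank ℚ k ≠ 0 := Module.finrank_pos.ne'
  have hd' : (Module.finrank ℚ k : ℝ) ≠ 0 := by exact_mod_cast hd
  obtain ⟨C, hC, h⟩ := exists_prime_not_dvd_le (ε := ε / Module.finrank ℚ k) (by positivity)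
  refine ⟨C ^ Module.finrank ℚ k, by positivity, fun θ hθ => ?_⟩
  obtain ⟨p, hp, hdvd, hle⟩ := h (Ideal.absNorm (Ideal.span {θ})) (by
    rwa [Ne, Ideal.absNorm_eq_zero_iff, Ideal.span_singleton_eq_bot])
  obtain ⟨v, hv, hv'⟩ := exists_heightOneSpectrum_notMem hp hdvd
  refine ⟨v, hv, ?_⟩
  have hN : ((Ideal.absNorm (Ideal.span {θ}) : ℕ) : ℝ) =
      ∏ w : InfinitePlace k, w θ ^ w.mult := by
    rw [InfinitePlace.prod_eq_abs_norm, Ideal.absNorm_span_singleton, Nat.cast_natAbs,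
      ← Algebra.coe_norm_int]
    push_cast
    rfl
  rw [← hN]
  calc (Ideal.absNorm v.asIdeal : ℝ) ≤ (p : ℝ) ^ Module.finrank ℚ k := by exact_mod_cast hv'
    _ ≤ (C * ((Ideal.absNorm (Ideal.span {θ}) : ℕ) : ℝ) ^ (ε / Module.finrank ℚ k)) ^
        Module.finrank ℚ k := by gcongr
    _ = _ := by
      rw [mul_pow, ← Real.rpow_mul_natCast (by positivity), div_mul_cancel₀ _ hd']

theorem exists_bound_eval {ι : Type} (g : MvPolynomial ι (𝓞 k)) :
    ∃ C : ℝ, 1 ≤ C ∧ ∃ D : ℕ, ∀ (w : InfinitePlace k) (R : ℝ), 1 ≤ R → ∀ z : ι → 𝓞 k,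
      (∀ i, w (z i) ≤ R) → w (eval z g : 𝓞 k) ≤ C * R ^ D := by
  induction g using MvPolynomial.induction_on with
  | C c =>
    refine ⟨1 + ∑ w : InfinitePlace k, w c, ?_, 0, fun w R _ z _ => ?_⟩
    · have : 0 ≤ ∑ w : InfinitePlace k, w c := Finset.sum_nonneg fun w _ => apply_nonneg w _
      linarith
    · rw [eval_C, pow_zero, mul_one]
      have := Finset.single_le_sum (f := fun w : InfinitePlace k => w c)
        (fun w _ => apply_nonneg w _) (Finset.mem_univ w)
      linarith
  | add p q hp hq =>
    obtain ⟨C, hC, D, h⟩ := hp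
    obtain ⟨C', hC', D', h'⟩ := hq
    refine ⟨C + C', by linarith, D + D', fun w R hR z hz => ?_⟩
    have h1 := h w R hR z hz
    have h2 := h' w R hR z hz
    have h3 : R ^ D ≤ R ^ (D + D') := pow_le_pow_right₀ hR (by omega)
    have h4 : R ^ D' ≤ R ^ (D + D') := pow_le_pow_right₀ hR (by omega)
    have e : ((eval z (p + q) : 𝓞 k) : k) = (eval z p : 𝓞 k) + (eval z q : 𝓞 k) := by
      simp
    rw [e, add_mul]
    refine (AbsoluteValue.add_le w.1 _ _).trans (add_le_add (h1.trans ?_) (h2.trans ?_)) <;> gcongr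
  | mul_X p i hp =>
    obtain ⟨C, hC, D, h⟩ := hp
    refine ⟨C, hC, D + 1, fun w R hR z hz => ?_⟩
    have e : ((eval z (p * X i) : 𝓞 k) : k) = (eval z p : 𝓞 k) * z i := by
      simp
    rw [e, map_mul, pow_succ, ← mul_assoc]
    exact mul_le_mul (h w R hR z hz) (hz i) (apply_nonneg w _) (by positivity)

theorem exists_notMem_absNorm_le_rpow {ι : Type} (g : MvPolynomial ι (𝓞 k)) {C₀ : ℝ} (hC₀ : 1 ≤ C₀)
    {ε : ℝ} (hε : 0 < ε) : ∃ C : ℝ, 0 < C ∧ ∀ (z : ι → 𝓞 k) (h : ℝ), 1 ≤ h →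
      (∀ (w : InfinitePlace k) i, w (z i) ≤ C₀ * h ^ ((Module.finrank ℚ k : ℝ)⁻¹)) →
      eval z g ≠ 0 → ∃ v : HeightOneSpectrum (𝓞 k), eval z g ∉ v.asIdeal ∧
        (Ideal.absNorm v.asIdeal : ℝ) ≤ C * h ^ ε := by
  set d := Module.finrank ℚ k with hd
  have hd0 : d ≠ 0 := Module.finrank_pos.ne'
  have hd' : (d : ℝ) ≠ 0 := by exact_mod_cast hd0
  obtain ⟨C₁, hC₁, D, hg⟩ := exists_bound_eval g
  obtain ⟨C₂, hC₂, hv⟩ := exists_notMem_absNorm_le k (ε := ε / (D + 1)) (by positivity)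
  refine ⟨C₂ * ((C₁ * C₀ ^ D) ^ d) ^ (ε / (D + 1)), by positivity, fun z h hh hz hne => ?_⟩
  obtain ⟨v, hmem, hle⟩ := hv _ hne
  refine ⟨v, hmem, hle.trans ?_⟩
  have hh0 : 0 < h := one_pos.trans_le hh
  have hR : 1 ≤ C₀ * h ^ ((d : ℝ)⁻¹) :=
    one_le_mul_of_one_le_of_one_le hC₀ (Real.one_le_rpow hh (by positivity))
  have hprod : ∏ w : InfinitePlace k, w (eval z g : 𝓞 k) ^ w.mult ≤
      (C₁ * C₀ ^ D) ^ d * h ^ (D : ℝ) := by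
    calc ∏ w : InfinitePlace k, w (eval z g : 𝓞 k) ^ w.mult
        ≤ ∏ w : InfinitePlace k, (C₁ * (C₀ * h ^ ((d : ℝ)⁻¹)) ^ D) ^ w.mult := by
          refine Finset.prod_le_prod (fun w _ => by positivity) fun w _ => ?_
          exact pow_le_pow_left₀ (apply_nonneg w _) (hg w _ hR z (hz w)) _
      _ = (C₁ * (C₀ * h ^ ((d : ℝ)⁻¹)) ^ D) ^ d := by
          rw [Finset.prod_pow_eq_pow_sum, InfinitePlace.sum_mult_eq]
      _ = (C₁ * C₀ ^ D) ^ d * ((h ^ ((d : ℝ)⁻¹)) ^ d) ^ D := by ring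
      _ = _ := by
          rw [← Real.rpow_mul_natCast hh0.le, inv_mul_cancel₀ hd', Real.rpow_one,
            Real.rpow_natCast]
  have hK : 0 ≤ (C₁ * C₀ ^ D) ^ d := by positivity
  calc C₂ * (∏ w : InfinitePlace k, w (eval z g : 𝓞 k) ^ w.mult) ^ (ε / (D + 1))
      ≤ C₂ * ((C₁ * C₀ ^ D) ^ d * h ^ (D : ℝ)) ^ (ε / (D + 1)) := by
        gcongr
    _ = C₂ * ((C₁ * C₀ ^ D) ^ d) ^ (ε / (D + 1)) * h ^ (D * (ε / (D + 1))) := by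
        rw [Real.mul_rpow hK (by positivity), ← Real.rpow_mul hh0.le, mul_assoc]
    _ ≤ C₂ * ((C₁ * C₀ ^ D) ^ d) ^ (ε / (D + 1)) * h ^ ε := by
        refine mul_le_mul_of_nonneg_left (Real.rpow_le_rpow_of_exponent_le hh ?_) (by positivity)
        rw [mul_div_assoc', div_le_iff₀ (by positivity)]
        nlinarith

end PrimeChoice

section Fibres

theorem aeval_smul_of_isHomogeneous {m : ℕ} {p : MvPolynomial (Fin (n + 1)) (𝓞 k)}
    (hp : p.IsHomogeneous m) (l : k) (y : Fin (n + 1) → k) :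
    aeval (fun i => l * y i) p = l ^ m * aeval y p := by
  rw [aeval_def, aeval_def, eval₂_eq', eval₂_eq', Finset.mul_sum]
  refine Finset.sum_congr rfl fun d hd => ?_
  have hdeg : ∑ i, d i = m := by
    have := hp (mem_support_iff.1 hd)
    rw [Finsupp.weight_apply, Finsupp.sum_fintype _ _ (by simp)] at this
    simpa using this
  rw [← hdeg, ← Finset.prod_pow_eq_pow_sum]
  simp only [mul_pow, Finset.prod_mul_distrib]
  ring

theorem DegOK.aeval_smul {a : Fin 3 → ℤ} {e : ℤ}
    {f : Fin 3 → Fin 3 → MvPolynomial (Fin (n + 1)) (𝓞 k)} (hf : DegOK a e f) (i j : Fin 3)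
    (l : kˣ) (y : Fin (n + 1) → k) :
    aeval (fun i => (l : k) * y i) (f i j) = (l : k) ^ (a i + a j + e) * aeval y (f i j) := by
  obtain ⟨-, h1, h2⟩ := hf i j
  by_cases h : a i + a j + e < 0
  · simp [h2 h]
  · rw [aeval_smul_of_isHomogeneous h1, ← zpow_natCast, Int.toNat_of_nonneg (by omega)]

theorem aeval_integer (p : MvPolynomial (Fin (n + 1)) (𝓞 k)) (z : Fin (n + 1) → 𝓞 k) :
    aeval (fun i => (z i : k)) p = ((eval z p : 𝓞 k) : k) := by
  have := aeval_algebraMap_apply (B := k) z p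
  rwa [aeval_eq_eval] at this

theorem det_aeval_integer (f : Fin 3 → Fin 3 → MvPolynomial (Fin (n + 1)) (𝓞 k))
    (z : Fin (n + 1) → 𝓞 k) :
    Deltak f (fun i => (z i : k)) = ((eval z (Matrix.of f).det : 𝓞 k) : k) := by
  rw [← aeval_integer, Deltak, AlgHom.map_det]
  rfl

theorem nonempty_representative {a : Fin 3 → ℤ} {e : ℤ}
    {f : Fin 3 → Fin 3 → MvPolynomial (Fin (n + 1)) (𝓞 k)} (hf : DegOK a e f)
    {z : Fin (n + 1) → k} (hz : z ≠ 0) {P : PtRep k n f} (hP : P ∈ fiberSet f z) :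
    ∃ P' : PtRep k n f, P'.y = z ∧ ptRel a f P' P ∧ (P.x 2 ≠ 0 → P'.x 2 ≠ 0) := by
  obtain ⟨l, hl⟩ := hP
  have hl0 : (l : k) ≠ 0 := l.ne_zero
  have hy : P.y = fun i => (l : k) * z i := funext hl
  refine ⟨⟨z, fun j => (l : k) ^ a j * P.x j, hz, ?_, ?_⟩, rfl, ⟨l, 1, hl, fun j => ?_⟩,
    fun h => ?_⟩
  · obtain ⟨j, hj⟩ := Function.ne_iff.1 P.hx
    exact Function.ne_iff.2 ⟨j, mul_ne_zero (zpow_ne_zero _ hl0) hj⟩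
  · have h := P.hQ
    rw [hy] at h
    have h2 : ∀ i j, aeval (fun i => (l : k) * z i) (f i j) * P.x i * P.x j =
        (l : k) ^ e * (aeval z (f i j) * ((l : k) ^ a i * P.x i) * ((l : k) ^ a j * P.x j)) := by
      intro i j
      rw [hf.aeval_smul, zpow_add₀ hl0, zpow_add₀ hl0]
      ring
    simp only [h2, ← Finset.mul_sum] at h
    exact (mul_eq_zero.1 h).resolve_left (zpow_ne_zero _ hl0)
  · simp only [mul_one, zpow_neg, Units.val_inv_eq_inv_val, Units.val_zpow_eq_zpow_val]
    rw [inv_mul_cancel_left₀ (zpow_ne_zero _ hl0)]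
  · exact mul_ne_zero (zpow_ne_zero _ hl0) h

/-- The points counted by `Ncount`. -/
def countSet (a : Fin 3 → ℤ) (f : Fin 3 → Fin 3 → MvPolynomial (Fin (n + 1)) (𝓞 k))
    (U : Set (PtRep k n f)) (H : PtRep k n f → ℝ) (B : ℝ) : Set (Quot (ptRel a f)) :=
  {q | ∃ P, P ∈ U ∧ H P ≤ B ∧ Quot.mk (ptRel a f) P = q}

theorem countSet_fibre_card_le {a : Fin 3 → ℤ} (ha : a 0 ≤ a 1 ∧ a 1 ≤ a 2) {e : ℤ}
    {f : Fin 3 → Fin 3 → MvPolynomial (Fin (n + 1)) (𝓞 k)} (hf : DegOK a e f) {α : ℚ}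
    {H : PtRep k n f → ℝ} (hHinv : ∀ P P', ptRel a f P P' → H P = H P') {c₁ : ℝ} (hc₁ : 0 < c₁)
    (hH : ∀ P, c₁ * Hstd a e α f P ≤ H P) {U : Set (PtRep k n f)} (hUx : ∀ P ∈ U, P.x 2 ≠ 0)
    {z : Fin (n + 1) → 𝓞 k} {v : HeightOneSpectrum (𝓞 k)} {i₀ : Fin (n + 1)}
    (hv : eval z (2 * (Matrix.of f).det * X i₀) ∉ v.asIdeal) {B : ℝ} (hB : 0 ≤ B) :
    (countSet a f (U ∩ fiberSet f fun i => (z i : k)) H B).Finite ∧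
      (Ncount a f (U ∩ fiberSet f fun i => (z i : k)) H B : ℝ) ≤
        12 * (Ideal.absNorm v.asIdeal : ℝ) ^ 2 * (6 ^ Module.finrank ℚ k *
          (B / (c₁ * ht (fun i => (z i : k)) ^ Aexp n a e α)) *
          ht (fun i => (z i : k)) ^ (-(((a 0 + a 1 + a 2 : ℤ) : ℝ) / 3))) := by
  set y : Fin (n + 1) → k := fun i => (z i : k) with hy_def
  have hmul : ∀ s t : 𝓞 k, s * t ∉ v.asIdeal → s ∉ v.asIdeal ∧ t ∉ v.asIdeal := fun s t h =>
    ⟨fun hs => h (v.asIdeal.mul_mem_right t hs), fun ht => h (v.asIdeal.mul_mem_left s ht)⟩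
  rw [map_mul, map_mul, eval_X] at hv
  obtain ⟨hv2, hvz⟩ := hmul _ _ hv
  obtain ⟨hv2, hvΔ⟩ := hmul _ _ hv2
  have hnz : nrm (.inr v) (z i₀ : k) = 1 := (nrm_integer_eq_one_iff v _).2 hvz
  have hy : y ≠ 0 := Function.ne_iff.2 ⟨i₀, fun h => by
    change (z i₀ : k) = 0 at h
    rw [h, map_zero] at hnz
    exact zero_ne_one hnz⟩
  have hyv : vmax (.inr v) y = 1 :=
    le_antisymm (vmax_le fun i => nrm_integer_le_one v (z i))
      (hnz.symm.le.trans (nrm_le_vmax (.inr v) y i₀))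
  have hh0 : 0 < ht y := one_pos.trans_le (one_le_ht hy)
  have h2 : nrm (.inr v) (2 : k) = 1 := by
    have := (nrm_integer_eq_one_iff v _).2 hv2
    have h' : (((2 : 𝓞 k)) : k) = 2 := map_ofNat (algebraMap (𝓞 k) k) 2
    rwa [map_ofNat, h'] at this
  let F : Matrix (Fin 3) (Fin 3) k := Matrix.of fun i j => aeval y (f i j)
  have hFsymm : ∀ i j, F i j = F j i := fun i j => by
    simp only [F, Matrix.of_apply, (hf i j).1]
  have hint : ∀ i j, nrm (.inr v) (F i j) ≤ 1 := fun i j => by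
    simp only [F, Matrix.of_apply, hy_def, aeval_integer]
    exact nrm_integer_le_one v _
  have hdet : nrm (.inr v) F.det = 1 := by
    change nrm (.inr v) (Deltak f y) = 1
    rw [hy_def, det_aeval_integer]
    exact (nrm_integer_eq_one_iff v _).2 hvΔ
  let S := {q : Quot (ptRel a f) // ∃ P, P ∈ U ∩ fiberSet f y ∧ H P ≤ B ∧ Quot.mk (ptRel a f) P = q}
  have hex : ∀ q : S, ∃ P' : PtRep k n f, P'.y = y ∧ Quot.mk (ptRel a f) P' = q.1 ∧
      P'.x 2 ≠ 0 ∧ H P' ≤ B := by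
    rintro ⟨q, P, ⟨hPU, hPy⟩, hPB, hPq⟩
    obtain ⟨P', h1, h2, h3⟩ := nonempty_representative hf hy hPy
    exact ⟨P', h1, (Quot.sound h2).trans hPq, h3 (hUx P hPU), (hHinv _ _ h2).trans_le hPB⟩
  choose R hRy hRq hRx hRB using hex
  exact card_fibre_le ha hy hyv hFsymm hint hdet h2 (ι := S) (fun p => (R p).x) hRx
    (fun p => by
      have := (R p).hQ
      rw [hRy] at this
      exact this)
    (fun p r hpr => by
      rintro ⟨c, hc⟩
      have hc0 : c ≠ 0 := by
        rintro rfl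
        exact hRx r (by simp [hc])
      refine hpr (Subtype.ext ?_)
      rw [← hRq p, ← hRq r]
      refine Quot.sound ⟨1, Units.mk0 c hc0, fun i => by simp [hRy], fun j => by simp [hc]⟩)
    (fun p => by
      have h := (hH (R p)).trans (hRB p)
      rw [Hstd_eq, hRy] at h
      rw [le_div_iff₀ (by positivity)]
      linarith)
    (by positivity)

end Fibres

section BaseClasses

theorem projRel_equivalence : Equivalence (projRel (k := k) (n := n)) where
  refl _ := ⟨1, by simp⟩
  symm := by
    rintro _ _ ⟨l, hl⟩
    exact ⟨l⁻¹, fun i => by simp [hl]⟩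
  trans := by
    rintro _ _ _ ⟨l, hl⟩ ⟨m, hm⟩
    exact ⟨m * l, fun i => by simp [hl, hm, mul_assoc]⟩

theorem projRel_mk_eq_iff {y y' : {z : Fin (n + 1) → k // z ≠ 0}} :
    Quot.mk projRel y = Quot.mk projRel y' ↔ projRel y y' :=
  ⟨fun h => projRel_equivalence.eqvGen_iff.1 (Quot.eqvGen_exact h), Quot.sound⟩

variable (k n) in
theorem exists_integral_representatives : ∃ C : ℝ, 1 ≤ C ∧
    ∃ Z : Quot (projRel (k := k) (n := n)) → Fin (n + 1) → 𝓞 k, ∀ q,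
      (∃ h : (fun i => (Z q i : k)) ≠ 0, Quot.mk projRel ⟨fun i => (Z q i : k), h⟩ = q) ∧
      ∀ (w : InfinitePlace k) i, w (Z q i) ≤
        C * ht (fun i => (Z q i : k)) ^ ((Module.finrank ℚ k : ℝ)⁻¹) := by
  obtain ⟨C, hC, h⟩ := exists_integral_rep k (Fin (n + 1))
  have : ∀ q : Quot (projRel (k := k) (n := n)), ∃ z : Fin (n + 1) → 𝓞 k,
      (∃ h : (fun i => (z i : k)) ≠ 0, Quot.mk projRel ⟨fun i => (z i : k), h⟩ = q) ∧
      ∀ (w : InfinitePlace k) i, w (z i) ≤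
        C * ht (fun i => (z i : k)) ^ ((Module.finrank ℚ k : ℝ)⁻¹) := by
    rintro ⟨y, hy⟩
    obtain ⟨l, z, hz, hw⟩ := h y hy
    have hz' : (fun i => (z i : k)) = fun i => (l : k) * y i := funext hz
    have hht : ht (fun i => (z i : k)) = ht y := by
      rw [hz']
      exact ht_smul l.ne_zero hy
    refine ⟨z, ⟨?_, ?_⟩, fun w i => by rw [hht]; exact hw w i⟩
    · obtain ⟨i, hi⟩ := Function.ne_iff.1 hy
      exact Function.ne_iff.2 ⟨i, by rw [hz]; exact mul_ne_zero l.ne_zero hi⟩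
    · exact (Quot.sound ⟨l, hz⟩).symm
  choose Z hZ using this
  exact ⟨C, hC, Z, hZ⟩

theorem DegOK.deltak_smul_ne_zero {a : Fin 3 → ℤ} {e : ℤ}
    {f : Fin 3 → Fin 3 → MvPolynomial (Fin (n + 1)) (𝓞 k)} (hf : DegOK a e f) (l : kˣ)
    {y : Fin (n + 1) → k} (hy : Deltak f y ≠ 0) : Deltak f (fun i => (l : k) * y i) ≠ 0 := by
  have hl : (l : k) ≠ 0 := l.ne_zero
  have h : (Matrix.of fun i j => aeval (fun i => (l : k) * y i) (f i j)) =
      Matrix.of fun i j => ((l : k) ^ (a j + e)) *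
        (Matrix.of fun i j => (l : k) ^ a i * (Matrix.of fun i j => aeval y (f i j)) i j) i j := by
    ext i j
    simp only [Matrix.of_apply]
    rw [hf.aeval_smul, ← mul_assoc, ← zpow_add₀ hl]
    congr 2
    ring
  rw [Deltak, h, Matrix.det_mul_row, Matrix.det_mul_column]
  exact mul_ne_zero (Finset.prod_ne_zero_iff.2 fun i _ => zpow_ne_zero _ hl)
    (mul_ne_zero (Finset.prod_ne_zero_iff.2 fun i _ => zpow_ne_zero _ hl) hy)

theorem DegOK.deltak_ne_zero_of_mem {a : Fin 3 → ℤ} {e : ℤ}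
    {f : Fin 3 → Fin 3 → MvPolynomial (Fin (n + 1)) (𝓞 k)} (hf : DegOK a e f)
    {q : Quot (projRel (k := k) (n := n))} (hq : q ∈ deltaNonzeroClasses f)
    {y : {z : Fin (n + 1) → k // z ≠ 0}} (hy : Quot.mk projRel y = q) : Deltak f y.1 ≠ 0 := by
  obtain ⟨yr, hyr, hΔ⟩ := hq
  obtain ⟨l, hl⟩ := projRel_mk_eq_iff.1 (hyr.trans hy.symm)
  rw [show y.1 = fun i => (l : k) * yr.1 i from funext hl]
  exact hf.deltak_smul_ne_zero l hΔ

theorem mk_eq_of_mem_fiberSet {f : Fin 3 → Fin 3 → MvPolynomial (Fin (n + 1)) (𝓞 k)}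
    {P : PtRep k n f} {y : Fin (n + 1) → k} (hy : y ≠ 0) :
    P ∈ fiberSet f y ↔ Quot.mk projRel ⟨P.y, P.hy⟩ = Quot.mk projRel ⟨y, hy⟩ :=
  ⟨fun h => (Quot.sound h).symm, fun h => projRel_mk_eq_iff.1 h.symm⟩

/-- The projection `X(k) → ℙⁿ(k)` on classes of representatives. -/
def baseClass (a : Fin 3 → ℤ) (f : Fin 3 → Fin 3 → MvPolynomial (Fin (n + 1)) (𝓞 k)) :
    Quot (ptRel a f) → Quot (projRel (k := k) (n := n)) :=
  Quot.lift (fun P => Quot.mk projRel ⟨P.y, P.hy⟩) fun _ _ ⟨l, _, hl, _⟩ => Quot.sound ⟨l, hl⟩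

theorem summable_ht_rpow {C : ℝ} (hC : 1 ≤ C)
    {Z : Quot (projRel (k := k) (n := n)) → Fin (n + 1) → 𝓞 k}
    (hZ : ∀ q, (∃ h : (fun i => (Z q i : k)) ≠ 0,
        Quot.mk projRel ⟨fun i => (Z q i : k), h⟩ = q) ∧
      ∀ (w : InfinitePlace k) i, w (Z q i) ≤
        C * ht (fun i => (Z q i : k)) ^ ((Module.finrank ℚ k : ℝ)⁻¹))
    {s : ℝ} (hs : (n : ℝ) + 1 < s) :
    Summable fun q => ht (fun i => (Z q i : k)) ^ (-s) := by
  set d := Module.finrank ℚ k with hd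
  have hd0 : 0 < (d : ℝ) := by exact_mod_cast Module.finrank_pos
  have hh0 : ∀ q, 0 < ht (fun i => (Z q i : k)) := fun q =>
    one_pos.trans_le (one_le_ht (hZ q).1.choose)
  have hinj : Function.Injective Z := fun q q' h => by
    obtain ⟨⟨h1, h2⟩, -⟩ := hZ q
    obtain ⟨⟨h1', h2'⟩, -⟩ := hZ q'
    rw [← h2, ← h2']
    congr 2
    rw [h]
  have hne : ∀ q, Z q ≠ 0 := fun q h => (hZ q).1.choose (by ext i; simp [h])
  have hsum := summable_rpow_of_le Z hinj hne (fun q => (hZ q).2)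
    (fun q => mul_pos (one_pos.trans_le hC) (Real.rpow_pos_of_pos (hh0 q) _)) (r := d * s) (by
      rw [Fintype.card_fin]
      push_cast
      gcongr)
  have hCpos : 0 < C := one_pos.trans_le hC
  refine (hsum.mul_left (C ^ ((d : ℝ) * s))).congr fun q => ?_
  rw [Real.mul_rpow hCpos.le (Real.rpow_nonneg (hh0 q).le _), ← Real.rpow_mul (hh0 q).le,
    ← mul_assoc, ← Real.rpow_add hCpos, add_neg_cancel, Real.rpow_zero, one_mul]
  congr 1
  field_simp

theorem exists_fibre_bound {a : Fin 3 → ℤ} (ha : a 0 ≤ a 1 ∧ a 1 ≤ a 2) {e : ℤ}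
    {f : Fin 3 → Fin 3 → MvPolynomial (Fin (n + 1)) (𝓞 k)} (hf : DegOK a e f) {α : ℚ}
    {H : PtRep k n f → ℝ} (hHinv : ∀ P P', ptRel a f P P' → H P = H P') {c₁ : ℝ} (hc₁ : 0 < c₁)
    (hH : ∀ P, c₁ * Hstd a e α f P ≤ H P) {U : Set (PtRep k n f)} (hUx : ∀ P ∈ U, P.x 2 ≠ 0)
    {C₀ : ℝ} (hC₀ : 1 ≤ C₀) {δ : ℝ} (hδ : 0 < δ)
    (hδα : Aexp n a e α + ((a 0 + a 1 + a 2 : ℤ) : ℝ) / 3 = n + 1 + δ) :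
    ∃ C : ℝ, 0 < C ∧ ∀ z : Fin (n + 1) → 𝓞 k, (fun i => (z i : k)) ≠ 0 →
      Deltak f (fun i => (z i : k)) ≠ 0 →
      (∀ (w : InfinitePlace k) i, w (z i) ≤
        C₀ * ht (fun i => (z i : k)) ^ ((Module.finrank ℚ k : ℝ)⁻¹)) → ∀ B : ℝ, 0 ≤ B →
      (countSet a f (U ∩ fiberSet f fun i => (z i : k)) H B).Finite ∧
        (Ncount a f (U ∩ fiberSet f fun i => (z i : k)) H B : ℝ) ≤
          B * (C * ht (fun i => (z i : k)) ^ (-(n + 1 + δ / 2))) := by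
  have hprime := fun i : Fin (n + 1) =>
    exists_notMem_absNorm_le_rpow (2 * (Matrix.of f).det * X i) hC₀ (ε := δ / 4) (by positivity)
  choose C hC hCv using hprime
  set K := ∑ i, C i with hK
  have hCK : ∀ i, C i ≤ K := fun i =>
    Finset.single_le_sum (fun i _ => (hC i).le) (Finset.mem_univ i)
  have hKpos : 0 < K := (hC 0).trans_le (hCK 0)
  refine ⟨12 * K ^ 2 * 6 ^ Module.finrank ℚ k / c₁, by positivity, fun z hz hΔ hw B hB => ?_⟩
  obtain ⟨i₀, hi₀⟩ := Function.ne_iff.1 hz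
  set h := ht (fun i => (z i : k)) with hh
  have hh1 : 1 ≤ h := one_le_ht hz
  have hh0 : 0 < h := one_pos.trans_le hh1
  have hne : eval z (2 * (Matrix.of f).det * X i₀) ≠ 0 := by
    rw [map_mul, map_mul, eval_X, map_ofNat]
    refine mul_ne_zero (mul_ne_zero two_ne_zero fun h0 => hΔ ?_) fun h0 => hi₀ ?_
    · rw [det_aeval_integer, h0]; simp
    · change (z i₀ : k) = 0
      rw [h0]; simp
  obtain ⟨v, hv, hvle⟩ := hCv i₀ z h hh1 hw hne
  obtain ⟨hfin, hcard⟩ := countSet_fibre_card_le ha hf hHinv hc₁ hH hUx hv hB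
  refine ⟨hfin, hcard.trans ?_⟩
  rw [← hh]
  have hvle' : (Ideal.absNorm v.asIdeal : ℝ) ≤ K * h ^ (δ / 4) :=
    hvle.trans (by gcongr; exact hCK i₀)
  have hrpow : h ^ (-(n + 1 + δ / 2)) = (h ^ (δ / 4)) ^ 2 * (h ^ Aexp n a e α)⁻¹ *
      h ^ (-(((a 0 + a 1 + a 2 : ℤ) : ℝ) / 3)) := by
    rw [← Real.rpow_mul_natCast hh0.le, ← Real.rpow_neg hh0.le, ← Real.rpow_add hh0,
      ← Real.rpow_add hh0]
    congr 1
    push_cast at hδα ⊢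
    linarith
  calc 12 * (Ideal.absNorm v.asIdeal : ℝ) ^ 2 * (6 ^ Module.finrank ℚ k *
          (B / (c₁ * h ^ Aexp n a e α)) * h ^ (-(((a 0 + a 1 + a 2 : ℤ) : ℝ) / 3)))
      ≤ 12 * (K * h ^ (δ / 4)) ^ 2 * (6 ^ Module.finrank ℚ k *
          (B / (c₁ * h ^ Aexp n a e α)) * h ^ (-(((a 0 + a 1 + a 2 : ℤ) : ℝ) / 3))) := by
        gcongr
    _ = _ := by
        rw [hrpow]
        field_simp

theorem Ncount_eq_ncard (a : Fin 3 → ℤ) (f : Fin 3 → Fin 3 → MvPolynomial (Fin (n + 1)) (𝓞 k))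
    (U : Set (PtRep k n f)) (H : PtRep k n f → ℝ) (B : ℝ) :
    Ncount a f U H B = (countSet a f U H B).ncard := rfl

theorem Ncount_eq_tsum {a : Fin 3 → ℤ} {f : Fin 3 → Fin 3 → MvPolynomial (Fin (n + 1)) (𝓞 k)}
    {U : Set (PtRep k n f)} {H : PtRep k n f → ℝ} {B : ℝ} (hUΔ : ∀ P ∈ U, Deltak f P.y ≠ 0)
    {Y : Quot (projRel (k := k) (n := n)) → Fin (n + 1) → k}
    (hY : ∀ q, ∃ h : Y q ≠ 0, Quot.mk projRel ⟨Y q, h⟩ = q)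
    (hfin : ∀ q ∈ deltaNonzeroClasses f, (countSet a f (U ∩ fiberSet f (Y q)) H B).Finite)
    {b : deltaNonzeroClasses f → ℝ} (hb : Summable b)
    (hle : ∀ q : deltaNonzeroClasses f, (Ncount a f (U ∩ fiberSet f (Y q.1)) H B : ℝ) ≤ b q) :
    (Ncount a f U H B : ℝ) =
      ∑' q : deltaNonzeroClasses f, (Ncount a f (U ∩ fiberSet f (Y q.1)) H B : ℝ) := by
  classical
  have hsupp : {q : deltaNonzeroClasses f |
      Ncount a f (U ∩ fiberSet f (Y q.1)) H B ≠ 0}.Finite := by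
    have := hb.tendsto_cofinite_zero.eventually (gt_mem_nhds one_pos)
    refine Set.Finite.subset this fun q hq hlt => hq ?_
    have : (Ncount a f (U ∩ fiberSet f (Y q.1)) H B : ℝ) < 1 := (hle q).trans_lt hlt
    exact Nat.lt_one_iff.1 (by exact_mod_cast this)
  set T := hsupp.toFinset with hT
  let S : deltaNonzeroClasses f → Finset (Quot (ptRel a f)) := fun q => (hfin q.1 q.2).toFinset
  have hScard : ∀ q, (S q).card = Ncount a f (U ∩ fiberSet f (Y q.1)) H B := fun q => by
    rw [Ncount_eq_ncard, Set.ncard_eq_toFinset_card _ (hfin q.1 q.2)]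
  have hmem : ∀ q x, x ∈ S q → baseClass a f x = q.1 := by
    intro q x hx
    obtain ⟨P, ⟨-, hP⟩, -, rfl⟩ := (Set.Finite.mem_toFinset _).1 hx
    obtain ⟨h1, h2⟩ := hY q.1
    exact ((mk_eq_of_mem_fiberSet h1).1 hP).trans h2
  have hunion : countSet a f U H B = (T.biUnion S : Set (Quot (ptRel a f))) := by
    ext x
    rw [Finset.mem_coe, Finset.mem_biUnion]
    constructor
    · rintro ⟨P, hPU, hPB, rfl⟩
      let q : deltaNonzeroClasses f :=
        ⟨Quot.mk projRel ⟨P.y, P.hy⟩, ⟨_, rfl, hUΔ P hPU⟩⟩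
      obtain ⟨h1, h2⟩ := hY q.1
      have hx : Quot.mk (ptRel a f) P ∈ S q := (Set.Finite.mem_toFinset _).2
        ⟨P, ⟨hPU, (mk_eq_of_mem_fiberSet h1).2 h2.symm⟩, hPB, rfl⟩
      refine ⟨q, (Set.Finite.mem_toFinset _).2 ?_, hx⟩
      change Ncount a f (U ∩ fiberSet f (Y q.1)) H B ≠ 0
      rw [← hScard]
      exact Finset.card_ne_zero_of_mem hx
    · rintro ⟨q, -, hx⟩
      obtain ⟨P, ⟨hPU, -⟩, hPB, hPx⟩ := (Set.Finite.mem_toFinset _).1 hx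
      exact ⟨P, hPU, hPB, hPx⟩
  rw [Ncount_eq_ncard, hunion, Set.ncard_coe_finset, Finset.card_biUnion, tsum_eq_sum (s := T)]
  · push_cast
    exact Finset.sum_congr rfl fun q _ => by rw [hScard]
  · intro q hq
    rw [hT, Set.Finite.mem_toFinset] at hq
    exact_mod_cast not_not.1 hq
  · intro q _ q' _ hqq'
    change Disjoint (S q) (S q')
    rw [Finset.disjoint_left]
    intro x hx hx'
    exact hqq' (Subtype.ext ((hmem q x hx).symm.trans (hmem q' x hx')))

end BaseClasses

/-- Theorem 3.8 (2),(3): the sum `c_{U,H} = ∑_{y : Δ(y) ≠ 0} c_y`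
of the fibre-wise leading constants converges, and `N(U,H,B) ~ c_{U,H}·B`. -/
theorem statement_2
    (k : Type) [Field k] [NumberField k]
    (n : ℕ) (hn : 1 ≤ n)
    (a : Fin 3 → ℤ) (ha : a 0 ≤ a 1 ∧ a 1 ≤ a 2) (e : ℤ)
    (f : Fin 3 → Fin 3 → MvPolynomial (Fin (n + 1)) (𝓞 k))
    (hf : DegOK a e f) (hsmooth : IsSmoothX f)
    (α : ℚ) (hα : (e : ℚ) + 2 * (((a 0 : ℚ) + (a 1 : ℚ) + (a 2 : ℚ)) / 3) < α)
    (H : PtRep k n f → ℝ)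
    (hHpos : ∀ P, 0 < H P)
    (hHinv : ∀ P P', ptRel a f P P' → H P = H P')
    (hH : ∃ c₁ c₂ : ℝ, 0 < c₁ ∧ c₁ ≤ c₂ ∧ ∀ P,
      c₁ * Hstd a e α f P ≤ H P ∧ H P ≤ c₂ * Hstd a e α f P)
    (U : Set (PtRep k n f))
    (ι : Type) (g : ι → MvPolynomial (Fin (n + 1) ⊕ Fin 3) k)
    (hg : ∀ i, IsBihom a (g i))
    (hUopen : U = {P | ∃ i, eval (Sum.elim P.y P.x) (g i) ≠ 0})
    (hUne : U.Nonempty)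
    (hUΔ : ∀ P ∈ U, Deltak f P.y ≠ 0)
    (hUx : ∀ P ∈ U, P.x 2 ≠ 0)
    -- the fibre-wise leading constants `c_y` (whose existence is Statement 1):
    (c : Quot (projRel (k := k) (n := n)) → ℝ)
    (hc : ∀ (y : Fin (n + 1) → k) (hy : y ≠ 0), Deltak f y ≠ 0 →
      Tendsto (fun B : ℝ => (Ncount a f (U ∩ fiberSet f y) H B : ℝ) / B) atTop
        (𝓝 (c (Quot.mk projRel ⟨y, hy⟩)))) :
    Summable (fun q : deltaNonzeroClasses f => c q.1) ∧
      Tendsto (fun B : ℝ => (Ncount a f U H B : ℝ) / B) atTop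
        (𝓝 (∑' q : deltaNonzeroClasses f, c q.1)) := by
  obtain ⟨c₁, c₂, hc₁, -, hH'⟩ := hH
  have hH : ∀ P, c₁ * Hstd a e α f P ≤ H P := fun P => (hH' P).1
  set δ : ℝ := α - e - 2 * (((a 0 : ℝ) + a 1 + a 2) / 3) with hδdef
  have hδ : 0 < δ := by
    have : (e : ℝ) + 2 * (((a 0 : ℝ) + a 1 + a 2) / 3) < α := by exact_mod_cast hα
    linarith
  have hδα : Aexp n a e α + ((a 0 + a 1 + a 2 : ℤ) : ℝ) / 3 = n + 1 + δ := by
    rw [Aexp, hδdef]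
    push_cast
    ring
  obtain ⟨C₀, hC₀, Z, hZ⟩ := exists_integral_representatives k n
  obtain ⟨C, hC, hCb⟩ := exists_fibre_bound ha hf hHinv hc₁ hH hUx hC₀ hδ hδα
  set bnd : deltaNonzeroClasses f → ℝ := fun q =>
    C * ht (fun i => (Z q.1 i : k)) ^ (-(n + 1 + δ / 2)) with hbnd
  have hsum := summable_ht_rpow hC₀ hZ (s := n + 1 + δ / 2) (by linarith)
  have hbsum : Summable bnd := (hsum.mul_left C).subtype (deltaNonzeroClasses f)
  have hΔ : ∀ q : deltaNonzeroClasses f, Deltak f (fun i => (Z q.1 i : k)) ≠ 0 := fun q => by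
    obtain ⟨⟨h1, h2⟩, -⟩ := hZ q.1
    exact DegOK.deltak_ne_zero_of_mem (y := ⟨_, h1⟩) hf q.2 h2
  have hfib := fun q : deltaNonzeroClasses f =>
    hCb (Z q.1) (hZ q.1).1.choose (hΔ q) (hZ q.1).2
  have hle : ∀ q : deltaNonzeroClasses f, ∀ B : ℝ, 0 < B →
      (Ncount a f (U ∩ fiberSet f fun i => (Z q.1 i : k)) H B : ℝ) / B ≤ bnd q := fun q B hB => by
    rw [div_le_iff₀' hB]
    exact (hfib q B hB.le).2
  have hlim : ∀ q : deltaNonzeroClasses f,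
      Tendsto (fun B : ℝ => (Ncount a f (U ∩ fiberSet f fun i => (Z q.1 i : k)) H B : ℝ) / B)
        atTop (𝓝 (c q.1)) := fun q => by
    obtain ⟨⟨h1, h2⟩, -⟩ := hZ q.1
    have := hc _ h1 (hΔ q)
    rwa [h2] at this
  have hnorm : ∀ᶠ B : ℝ in atTop, ∀ q : deltaNonzeroClasses f,
      ‖(Ncount a f (U ∩ fiberSet f fun i => (Z q.1 i : k)) H B : ℝ) / B‖ ≤ bnd q := by
    filter_upwards [eventually_gt_atTop 0] with B hB q
    rw [Real.norm_of_nonneg (by positivity)]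
    exact hle q B hB
  refine ⟨hbsum.of_norm_bounded fun q =>
    le_of_tendsto (hlim q).norm (hnorm.mono fun B hB => hB q), ?_⟩
  refine (tendsto_tsum_of_dominated_convergence hbsum hlim hnorm).congr' ?_
  filter_upwards [eventually_gt_atTop 0] with B hB
  rw [tsum_div_const, Ncount_eq_tsum hUΔ (Y := fun q i => (Z q i : k)) (fun q => (hZ q).1)
    (fun q hq => (hfib ⟨q, hq⟩ B hB.le).1) (hbsum.mul_left B) fun q => (hfib q B hB.le).2]

end Stmt
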